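/- Let 1<p₁,p₂<∞, 1/p = 1/p₁ + 1/p₂, 0<α<2n, α/n < 1/p₁ + 1/p₂, 1/q = 1/p₁ + 1/p₂ − α/n, and 1<p,q<∞. If the commutator [b,I_α]₁ is a compact bilinear operator from L^{p₁}(ℝⁿ) × L^{p₂}(ℝⁿ) to L^q(ℝⁿ), then b ∈ CMO. -/

import Mathlib

open MeasureTheory Set Filter
open scoped ENNReal BigOperators Topology

noncomputable section

/-- Euclidean space `ℝⁿ`. -/
abbrev Rn (n : ℕ) : Type := EuclideanSpace ℝ (Fin n)

/-- The closed axis-parallel cube with center `c` and side length `d`. -/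
def cube (n : ℕ) (c : Rn n) (d : ℝ) : Set (Rn n) :=
  {x | ∀ i : Fin n, |x i - c i| ≤ d / 2}

/-- The average `b_Q` of `b` over the cube with center `c` and side length `d`. -/
def cubeAvg (n : ℕ) (b : Rn n → ℝ) (c : Rn n) (d : ℝ) : ℝ :=
  ⨍ x in cube n c d, b x

/-- The mean oscillation `⨍_Q |b - b_Q|` of `b` over a cube. -/
def osc (n : ℕ) (b : Rn n → ℝ) (c : Rn n) (d : ℝ) : ℝ :=
  ⨍ x in cube n c d, |b x - cubeAvg n b c d|

/-- The BMO seminorm: supremum of mean oscillations over all axis-parallel cubes. -/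
def bmoNorm (n : ℕ) (b : Rn n → ℝ) : ℝ :=
  ⨆ cd : Rn n × {d : ℝ // 0 < d}, osc n b cd.1 cd.2.1

/-- `b ∈ CMO`: `b` belongs to the closure of `C_c^∞` in the BMO seminorm. -/
def MemCMO (n : ℕ) (b : Rn n → ℝ) : Prop :=
  ∀ ε : ℝ, 0 < ε → ∃ φ : Rn n → ℝ, ContDiff ℝ (⊤ : ℕ∞) φ ∧ HasCompactSupport φ ∧
    bmoNorm n (b - φ) < ε

/-- The conjugate exponent `p' = p/(p-1)`. -/
def conjExp (p : ℝ) : ℝ := p / (p - 1)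

/-- The Muckenhoupt class `A_p`. -/
def MuckenhouptAp (n : ℕ) (p : ℝ) (w : Rn n → ℝ) : Prop :=
  (∀ x, 0 ≤ w x) ∧ LocallyIntegrable w volume ∧
  ∃ C : ℝ, ∀ (c : Rn n) (d : ℝ), 0 < d →
    (⨍ x in cube n c d, w x) *
      (⨍ x in cube n c d, w x ^ (1 - conjExp p)) ^ (p / conjExp p) ≤ C

/-- The `A_p` characteristic constant `[w]_{A_p}`. -/
def apConst (n : ℕ) (p : ℝ) (w : Rn n → ℝ) : ℝ :=
  ⨆ cd : Rn n × {d : ℝ // 0 < d},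
    (⨍ x in cube n cd.1 cd.2.1, w x) *
      (⨍ x in cube n cd.1 cd.2.1, w x ^ (1 - conjExp p)) ^ (p / conjExp p)

/-- The bilinear class `A_{P,q}` for `P = (p₁,p₂)`. -/
def MuckenhouptAPq (n : ℕ) (p₁ p₂ q : ℝ) (w₁ w₂ : Rn n → ℝ) : Prop :=
  ∃ C : ℝ, ∀ (c : Rn n) (d : ℝ), 0 < d →
    (⨍ x in cube n c d, (w₁ x * w₂ x) ^ q) *
      (⨍ x in cube n c d, w₁ x ^ (-(conjExp p₁))) ^ (q / conjExp p₁) *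
      (⨍ x in cube n c d, w₂ x ^ (-(conjExp p₂))) ^ (q / conjExp p₂) ≤ C

/-- The kernel of the bilinear fractional integral `I_α`. -/
def fracKernel (n : ℕ) (α : ℝ) (x y z : Rn n) : ℝ :=
  (‖x - y‖ ^ 2 + ‖x - z‖ ^ 2) ^ (-((n : ℝ) - α / 2))

/-- The bilinear fractional integral operator `I_α`. -/
def Iop (n : ℕ) (α : ℝ) (f g : Rn n → ℝ) (x : Rn n) : ℝ :=
  ∫ y, ∫ z, fracKernel n α x y z * (f y * g z)

/-- The first commutator `[b, I_α]₁(f,g) = I_α(bf, g) - b · I_α(f,g)`. -/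
def commI (n : ℕ) (α : ℝ) (b f g : Rn n → ℝ) : Rn n → ℝ :=
  fun x => Iop n α (fun y => b y * f y) g x - b x * Iop n α f g x

/-- The weighted Lᵖ norm `(∫ |f|^p w)^{1/p}` (with value in `ℝ≥0∞`). -/
def wNorm (n : ℕ) (p : ℝ) (w : Rn n → ℝ) (f : Rn n → ℝ) : ℝ≥0∞ :=
  (∫⁻ x, ENNReal.ofReal (|f x| ^ p * w x)) ^ (1 / p)

/-- A bilinear operator `T` is compact from `L^{p₁}(w₁) × L^{p₂}(w₂)` to `L^q(μ)` when the
image of the product of unit balls is precompact in `L^q(μ)`; equivalently (by completeness),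
every sequence in the image of the unit balls admits a subsequence which is Cauchy for the
`L^q(μ)` norm. -/
def BilinCompact (n : ℕ) (p₁ p₂ q : ℝ) (w₁ w₂ μ : Rn n → ℝ)
    (T : (Rn n → ℝ) → (Rn n → ℝ) → Rn n → ℝ) : Prop :=
  ∀ F G : ℕ → Rn n → ℝ,
    (∀ j, wNorm n p₁ w₁ (F j) ≤ 1) → (∀ j, wNorm n p₂ w₂ (G j) ≤ 1) →
    ∃ φ : ℕ → ℕ, StrictMono φ ∧
      ∀ ε : ℝ, 0 < ε → ∃ N : ℕ, ∀ j ≥ N, ∀ k ≥ N,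
        wNorm n q μ (fun x => T (F (φ j)) (G (φ j)) x - T (F (φ k)) (G (φ k)) x)
          < ENNReal.ofReal ε

/-- The smoothly truncated kernel `K^δ` with implicit constant `A`. -/
def IsTruncKernel (n : ℕ) (α δ A : ℝ) (K : Rn n → Rn n → Rn n → ℝ) : Prop :=
  ContDiff ℝ 1 (fun pt : Rn n × Rn n × Rn n => K pt.1 pt.2.1 pt.2.2) ∧
  (∀ x y z, 2 * δ < max ‖x - y‖ ‖x - z‖ → K x y z = fracKernel n α x y z) ∧
  (∀ x y z, max ‖x - y‖ ‖x - z‖ < δ → K x y z = 0) ∧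
  (∀ x y z : Rn n, |K x y z| ≤ A * (‖x - y‖ + ‖x - z‖) ^ (-(2 * (n : ℝ) - α))) ∧
  (∀ x y z : Rn n,
    ‖fderiv ℝ (fun pt : Rn n × Rn n × Rn n => K pt.1 pt.2.1 pt.2.2) (x, y, z)‖ ≤
      A * (‖x - y‖ + ‖x - z‖) ^ (-(2 * (n : ℝ) - α - 1)))

/-- The bilinear operator with kernel `K`. -/
def IopK (n : ℕ) (K : Rn n → Rn n → Rn n → ℝ) (f g : Rn n → ℝ) (x : Rn n) : ℝ :=
  ∫ y, ∫ z, K x y z * (f y * g z)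

/-- The first commutator of the truncated operator. -/
def commIK (n : ℕ) (K : Rn n → Rn n → Rn n → ℝ) (b f g : Rn n → ℝ) : Rn n → ℝ :=
  fun x => IopK n K (fun y => b y * f y) g x - b x * IopK n K f g x

/-- The bilinear fractional maximal function `M_α`. -/
def Mmax (n : ℕ) (α : ℝ) (f g : Rn n → ℝ) (x : Rn n) : ℝ :=
  ⨆ cd : {cd : Rn n × ℝ // 0 < cd.2 ∧ x ∈ cube n cd.1 cd.2},
    ((cd : Rn n × ℝ).2 ^ n) ^ (α / n) *
      ((⨍ y in cube n (cd : Rn n × ℝ).1 (cd : Rn n × ℝ).2, |f y|) *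
        (⨍ z in cube n (cd : Rn n × ℝ).1 (cd : Rn n × ℝ).2, |g z|))

/-- The test function `f_j` associated to the cube with center `c`, side `d` and symbol `b`:
`f_j = |Q|^{-1/p₁} (sgn(b - b_Q) - c₀) χ_Q` where `c₀ = ⨍_Q sgn(b - b_Q)`. -/
def testF (n : ℕ) (p₁ : ℝ) (b : Rn n → ℝ) (c : Rn n) (d : ℝ) : Rn n → ℝ :=
  indicator (cube n c d) fun y =>
    (d ^ n) ^ (-(1 / p₁)) *
      (Real.sign (b y - cubeAvg n b c d) -
        ⨍ z in cube n c d, Real.sign (b z - cubeAvg n b c d))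

/-- The test function `g_j = |Q|^{-1/p₂} χ_Q` associated to the cube with center `c`, side `d`. -/
def testG (n : ℕ) (p₂ : ℝ) (c : Rn n) (d : ℝ) : Rn n → ℝ :=
  indicator (cube n c d) fun _ => (d ^ n) ^ (-(1 / p₂))

end


section basics

lemma cube_eq_preimage (n : ℕ) (c : Rn n) (d : ℝ) :
    cube n c d = (@WithLp.ofLp 2 (Fin n → ℝ)) ⁻¹'
      (Icc (fun i => c i - d / 2) (fun i => c i + d / 2)) := by
  ext x
  simp only [cube, mem_setOf_eq, mem_preimage, mem_Icc, Pi.le_def, abs_le]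
  constructor
  · intro h
    exact ⟨fun i => by linarith [(h i).1], fun i => by linarith [(h i).2]⟩
  · rintro ⟨h1, h2⟩ i
    exact ⟨by linarith [h1 i], by linarith [h2 i]⟩

lemma isClosed_cube (n : ℕ) (c : Rn n) (d : ℝ) : IsClosed (cube n c d) := by
  rw [cube_eq_preimage]
  exact isClosed_Icc.preimage (PiLp.continuous_ofLp 2 _)

lemma measurableSet_cube (n : ℕ) (c : Rn n) (d : ℝ) : MeasurableSet (cube n c d) :=
  (isClosed_cube n c d).measurableSet

lemma volume_cube (n : ℕ) (c : Rn n) (d : ℝ) (hd : 0 < d) :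
    volume (cube n c d) = ENNReal.ofReal (d ^ n) := by
  rw [cube_eq_preimage, (PiLp.volume_preserving_ofLp (Fin n)).measure_preimage
    measurableSet_Icc.nullMeasurableSet, Real.volume_Icc_pi]
  have : ∀ i : Fin n, (c i + d / 2) - (c i - d / 2) = d := fun i => by ring
  simp only [this, Finset.prod_const, Finset.card_univ, Fintype.card_fin]
  rw [ENNReal.ofReal_pow hd.le]

lemma volume_real_cube (n : ℕ) (c : Rn n) (d : ℝ) (hd : 0 < d) :
    volume.real (cube n c d) = d ^ n := by
  rw [Measure.real, volume_cube n c d hd, ENNReal.toReal_ofReal (by positivity)]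

lemma norm_sub_le_of_mem_cube {n : ℕ} {c : Rn n} {d : ℝ} (hd : 0 < d) {x : Rn n}
    (hx : x ∈ cube n c d) : ‖x - c‖ ≤ √n * d / 2 := by
  rw [EuclideanSpace.norm_eq]
  have h : ∑ i : Fin n, ‖(x - c) i‖ ^ 2 ≤ n * (d / 2) ^ 2 := by
    calc ∑ i : Fin n, ‖(x - c) i‖ ^ 2 ≤ ∑ i : Fin n, (d / 2) ^ 2 := by
          apply Finset.sum_le_sum
          intro i _
          have := hx i
          rw [Real.norm_eq_abs]
          simp only [PiLp.sub_apply]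
          gcongr
      _ = n * (d / 2) ^ 2 := by simp
  calc √(∑ i : Fin n, ‖(x - c) i‖ ^ 2) ≤ √(n * (d / 2) ^ 2) := Real.sqrt_le_sqrt h
    _ = √n * d / 2 := by
      rw [Real.sqrt_mul (by positivity), Real.sqrt_sq (by positivity)]; ring

lemma mem_cube_of_norm {n : ℕ} {c : Rn n} {d : ℝ} {x : Rn n}
    (hx : ‖x - c‖ ≤ d / 2) : x ∈ cube n c d := fun i => by
  have := PiLp.norm_apply_le (x - c) i
  rw [Real.norm_eq_abs] at this
  simp only [PiLp.sub_apply] at this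
  linarith

lemma mem_cube_comm {n : ℕ} {c : Rn n} {d : ℝ} {x : Rn n} :
    x ∈ cube n c d ↔ c ∈ cube n x d := by
  simp only [cube, mem_setOf_eq, abs_sub_comm]

lemma isCompact_cube (n : ℕ) (c : Rn n) (d : ℝ) (hd : 0 < d) : IsCompact (cube n c d) := by
  apply Metric.isCompact_of_isClosed_isBounded (isClosed_cube n c d)
  apply (Metric.isBounded_closedBall (x := c) (r := √n * d / 2)).subset
  intro x hx
  rw [Metric.mem_closedBall, dist_eq_norm]
  exact norm_sub_le_of_mem_cube hd hx

lemma center_mem_cube {n : ℕ} (c : Rn n) {d : ℝ} (hd : 0 < d) : c ∈ cube n c d := fun i => by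
  simp; positivity

lemma LI.cube {n : ℕ} {w : Rn n → ℝ} (hw : LocallyIntegrable w volume) (c : Rn n) {d : ℝ}
    (hd : 0 < d) : IntegrableOn w (cube n c d) volume :=
  hw.integrableOn_isCompact (isCompact_cube n c d hd)

lemma volume_cube_ne_top {n : ℕ} (c : Rn n) {d : ℝ} (hd : 0 < d) :
    volume (cube n c d) ≠ ∞ := by rw [volume_cube n c d hd]; exact ENNReal.ofReal_ne_top

lemma integrableOn_const_cube {n : ℕ} (c : Rn n) {d : ℝ} (hd : 0 < d) (k : ℝ) :
    IntegrableOn (fun _ => k) (cube n c d) volume :=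
  integrableOn_const (volume_cube_ne_top c hd)

lemma IOn.abs_sub {n : ℕ} {w : Rn n → ℝ} {c : Rn n} {d : ℝ} (hd : 0 < d)
    (hw : IntegrableOn w (cube n c d) volume)  (k : ℝ) :
    IntegrableOn (fun x => |w x - k|) (cube n c d) volume :=
  (hw.sub (integrableOn_const_cube c hd k)).abs

lemma cubeAvg_mul {n : ℕ} (w : Rn n → ℝ) (c : Rn n) {d : ℝ} (hd : 0 < d) :
    cubeAvg n w c d * d ^ n = ∫ x in cube n c d, w x := by
  have : (d ^ n : ℝ) ≠ 0 := by positivity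
  rw [cubeAvg, setAverage_eq, volume_real_cube n c d hd, smul_eq_mul]
  field_simp

lemma osc_mul {n : ℕ} (w : Rn n → ℝ) (c : Rn n) {d : ℝ} (hd : 0 < d) :
    osc n w c d * d ^ n = ∫ x in cube n c d, |w x - cubeAvg n w c d| := by
  have : (d ^ n : ℝ) ≠ 0 := by positivity
  rw [osc, setAverage_eq, volume_real_cube n c d hd, smul_eq_mul]
  field_simp

lemma osc_nonneg {n : ℕ} (w : Rn n → ℝ) (c : Rn n) {d : ℝ} (hd : 0 < d) :
    0 ≤ osc n w c d := by
  have h := osc_mul w c hd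
  have h2 : 0 ≤ ∫ x in cube n c d, |w x - cubeAvg n w c d| := by positivity
  rw [← h] at h2
  exact nonneg_of_mul_nonneg_left h2 (by positivity)

lemma setIntegral_const_cube {n : ℕ} (c : Rn n) {d : ℝ} (hd : 0 < d) (k : ℝ) :
    ∫ _ in cube n c d, k = k * d ^ n := by
  rw [setIntegral_const, volume_real_cube n c d hd, smul_eq_mul, mul_comm]

/-- average over a subcube is close to a constant -/
lemma avg_sub_le {n : ℕ} {w : Rn n → ℝ} {c c' : Rn n} {d d' : ℝ} (hd : 0 < d) (hd' : 0 < d')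
    (hw : LocallyIntegrable w volume) (hsub : cube n c d ⊆ cube n c' d') (k : ℝ) :
    |cubeAvg n w c d - k| * d ^ n ≤ ∫ x in cube n c' d', |w x - k| := by
  have h1 : (cubeAvg n w c d - k) * d ^ n = ∫ x in cube n c d, (w x - k) := by
    rw [integral_sub (LI.cube hw c hd) (integrableOn_const_cube c hd k), sub_mul,
      cubeAvg_mul w c hd, setIntegral_const_cube c hd]
  have h2 : |cubeAvg n w c d - k| * d ^ n = |(cubeAvg n w c d - k) * d ^ n| := by
    rw [abs_mul, abs_of_nonneg (show (0:ℝ) ≤ d ^ n by positivity)]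
  rw [h2, h1]
  calc |∫ x in cube n c d, (w x - k)| ≤ ∫ x in cube n c d, |w x - k| :=
        abs_integral_le_integral_abs
    _ ≤ ∫ x in cube n c' d', |w x - k| := by
        apply setIntegral_mono_set (IOn.abs_sub hd' (LI.cube hw c' hd') k)
        · exact Eventually.of_forall fun x => abs_nonneg _
        · exact hsub.eventuallyLE

lemma osc_le_of {n : ℕ} {w : Rn n → ℝ} {c : Rn n} {d : ℝ} (hd : 0 < d)
    (hw : LocallyIntegrable w volume) (k K : ℝ)
    (h : ∫ x in cube n c d, |w x - k| ≤ K * d ^ n) : osc n w c d ≤ 2 * K := by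
  have hdn : (0:ℝ) < d ^ n := by positivity
  have h1 := avg_sub_le hd hd hw (Subset.refl (cube n c d)) k
  have h2 : osc n w c d * d ^ n ≤ 2 * K * d ^ n := by
    rw [osc_mul w c hd]
    calc ∫ x in cube n c d, |w x - cubeAvg n w c d|
        ≤ ∫ x in cube n c d, (|w x - k| + |cubeAvg n w c d - k|) := by
          apply integral_mono (IOn.abs_sub hd (LI.cube hw c hd) _)
            ((IOn.abs_sub hd (LI.cube hw c hd) _).add (integrableOn_const_cube c hd _))
          intro x
          have := abs_sub_le (w x) k (cubeAvg n w c d)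
          rw [abs_sub_comm k] at this
          exact this
      _ = (∫ x in cube n c d, |w x - k|) + |cubeAvg n w c d - k| * d ^ n := by
          rw [integral_add (IOn.abs_sub hd (LI.cube hw c hd) _) (integrableOn_const_cube c hd _),
            setIntegral_const_cube c hd]
      _ ≤ 2 * K * d ^ n := by linarith
  exact le_of_mul_le_mul_right h2 hdn

end basics

section cutoff

lemma cube_mono {n : ℕ} {c : Rn n} {d d' : ℝ} (h : d ≤ d') : cube n c d ⊆ cube n c d' :=
  fun x hx i => (hx i).trans (by linarith)

lemma chain_bound {n : ℕ} {b : Rn n → ℝ} (hb : LocallyIntegrable b volume) {ε : ℝ} {c : Rn n}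
    {d : ℝ} (hd : 0 < d) (H : ∀ d', 0 < d' → osc n b c d' ≤ ε) (K : ℕ) :
    |cubeAvg n b c d - cubeAvg n b c (2 ^ K * d)| ≤ K * 2 ^ n * ε := by
  induction K with
  | zero => simp
  | succ K ih =>
    have h1 : 0 < 2 ^ K * d := by positivity
    have h2 : 0 < 2 ^ (K + 1) * d := by positivity
    have hsub : cube n c (2 ^ K * d) ⊆ cube n c (2 ^ (K + 1) * d) := by
      apply cube_mono; rw [pow_succ]; nlinarith
    have h3 := avg_sub_le h1 h2 hb hsub (cubeAvg n b c (2 ^ (K + 1) * d))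
    rw [← osc_mul b c h2] at h3
    have h4 := H _ h2
    have h5 : (2 ^ (K + 1) * d) ^ n = 2 ^ n * (2 ^ K * d) ^ n := by
      rw [← mul_pow]; congr 1; ring
    rw [h5] at h3
    have h6 : |cubeAvg n b c (2 ^ K * d) - cubeAvg n b c (2 ^ (K + 1) * d)| ≤ 2 ^ n * ε := by
      apply le_of_mul_le_mul_right (h3.trans _) (show 0 < (2 ^ K * d) ^ n by positivity)
      calc _ = osc n b c (2 ^ (K + 1) * d) * (2 ^ n * (2 ^ K * d) ^ n) := rfl
        _ ≤ ε * (2 ^ n * (2 ^ K * d) ^ n) := by gcongr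
        _ = _ := by ring
    have h7 := abs_sub_le (cubeAvg n b c d) (cubeAvg n b c (2 ^ K * d))
      (cubeAvg n b c (2 ^ (K + 1) * d))
    push_cast
    linarith

lemma avg_compare {n : ℕ} {b : Rn n → ℝ} (hb : LocallyIntegrable b volume) {ε : ℝ} {c : Rn n}
    {d R : ℝ} (hε : 0 ≤ ε) (hd : 0 < d) (hR : d ≤ R) (hc : ‖c‖ ≤ 3 * R)
    (H : ∀ d', 0 < d' → osc n b c d' ≤ ε) :
    |cubeAvg n b c d - cubeAvg n b 0 (4 * R)| * d ≤ (20 * 2 ^ n + 5 ^ n) * ε * R := by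
  have hR0 : 0 < R := hd.trans_le hR
  obtain ⟨m, hm1, hm2⟩ := exists_nat_pow_near (x := 10 * R / d) (y := 2)
    (by rw [le_div_iff₀ hd]; linarith) (by norm_num)
  rw [le_div_iff₀ hd] at hm1
  rw [div_lt_iff₀ hd] at hm2
  set K := m + 1 with hK
  have h1 := chain_bound hb hd H K
  have hD : 0 < 2 ^ K * d := by positivity
  have hD2 : 2 ^ K * d ≤ 20 * R := by rw [hK, pow_succ]; linarith
  have hsub : cube n 0 (4 * R) ⊆ cube n c (2 ^ K * d) := by
    intro x hx i
    have h2 := hx i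
    have h3 := PiLp.norm_apply_le c i
    rw [Real.norm_eq_abs] at h3
    have h4 : |x i - c i| ≤ |x i - (0 : Rn n) i| + |c i| := by
      simpa using abs_sub (x i) (c i)
    linarith
  have h3 := avg_sub_le (by positivity) hD hb hsub (cubeAvg n b c (2 ^ K * d))
  rw [← osc_mul b c hD] at h3
  have h6 : |cubeAvg n b 0 (4 * R) - cubeAvg n b c (2 ^ K * d)| ≤ 5 ^ n * ε := by
    apply le_of_mul_le_mul_right (h3.trans _) (show 0 < (4 * R) ^ n by positivity)
    calc _ ≤ ε * (20 * R) ^ n := by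
            gcongr
            exact H _ hD
      _ = _ := by
        have : (20 * R) ^ n = 5 ^ n * (4 * R) ^ n := by rw [← mul_pow]; congr 1; ring
        rw [this]; ring
  have h7 := abs_sub_le (cubeAvg n b c d) (cubeAvg n b c (2 ^ K * d)) (cubeAvg n b 0 (4 * R))
  rw [abs_sub_comm (cubeAvg n b c (2 ^ K * d))] at h7
  have hKd : (K : ℝ) * d ≤ 20 * R := by
    have : (K : ℝ) ≤ 2 ^ K := by exact_mod_cast Nat.lt_two_pow_self.le
    nlinarith
  calc |cubeAvg n b c d - cubeAvg n b 0 (4 * R)| * d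
      ≤ (K * 2 ^ n * ε + 5 ^ n * ε) * d := by gcongr; linarith
    _ = (K * d) * (2 ^ n * ε) + 5 ^ n * ε * d := by ring
    _ ≤ (20 * R) * (2 ^ n * ε) + 5 ^ n * ε * R := by gcongr
    _ = _ := by ring

/-- cutoff function -/
noncomputable def cutη (n : ℕ) (R : ℝ) (x : Rn n) : ℝ := max 0 (min 1 (2 - ‖x‖ / R))

lemma cutη_nonneg {n : ℕ} {R : ℝ} {x : Rn n} : 0 ≤ cutη n R x := le_max_left _ _
lemma cutη_le_one {n : ℕ} {R : ℝ} {x : Rn n} : cutη n R x ≤ 1 :=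
  max_le zero_le_one (min_le_left _ _)
lemma cutη_one {n : ℕ} {R : ℝ} (hR : 0 < R) {x : Rn n} (hx : ‖x‖ ≤ R) : cutη n R x = 1 := by
  have : ‖x‖ / R ≤ 1 := by rw [div_le_one hR]; exact hx
  rw [cutη, min_eq_left (by linarith), max_eq_right zero_le_one]
lemma cutη_zero {n : ℕ} {R : ℝ} (hR : 0 < R) {x : Rn n} (hx : 2 * R ≤ ‖x‖) :
    cutη n R x = 0 := by
  have : 2 ≤ ‖x‖ / R := by rw [le_div_iff₀ hR]; exact hx
  rw [cutη, max_eq_left ((min_le_right _ _).trans (by linarith))]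
lemma cutη_lip {n : ℕ} {R : ℝ} (hR : 0 < R) (x y : Rn n) :
    |cutη n R x - cutη n R y| ≤ ‖x - y‖ / R := by
  have h1 : |cutη n R x - cutη n R y| ≤ |min 1 (2 - ‖x‖ / R) - min 1 (2 - ‖y‖ / R)| := by
    have := abs_max_sub_max_le_abs (min 1 (2 - ‖x‖ / R)) (min 1 (2 - ‖y‖ / R)) 0
    rw [cutη, cutη, max_comm 0, max_comm 0]
    exact this
  have h2 : |min 1 (2 - ‖x‖ / R) - min 1 (2 - ‖y‖ / R)| ≤ |(2 - ‖x‖ / R) - (2 - ‖y‖ / R)| := by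
    have := abs_min_sub_min_le_max 1 (2 - ‖x‖ / R) 1 (2 - ‖y‖ / R)
    simpa using this
  have h3 : |(2 - ‖x‖ / R) - (2 - ‖y‖ / R)| ≤ ‖x - y‖ / R := by
    have : (2 - ‖x‖ / R) - (2 - ‖y‖ / R) = (‖y‖ - ‖x‖) / R := by ring
    rw [this, abs_div, abs_of_pos hR, norm_sub_rev]
    gcongr
    exact abs_norm_sub_norm_le y x
  linarith
lemma cutη_cont {n : ℕ} {R : ℝ} : Continuous (cutη n R) := by
  unfold cutη; fun_prop

noncomputable def Ccut (n : ℕ) : ℝ := 2 + (4 * √n) ^ n + √n * (20 * 2 ^ n + 5 ^ n)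

lemma cutoff_lemma {n : ℕ} (hn : 0 < n) {b : Rn n → ℝ} (hb : LocallyIntegrable b volume)
    {ε R₀ : ℝ} (hε : 0 ≤ ε) (hR₀ : 0 < R₀)
    (H : ∀ (c : Rn n) (d : ℝ), 0 < d → (R₀ ≤ ‖c‖ ∨ R₀ ≤ d) → osc n b c d ≤ ε) :
    ∃ v : Rn n → ℝ, LocallyIntegrable v volume ∧ HasCompactSupport v ∧
      ∀ (c : Rn n) (d : ℝ), 0 < d →
        ∃ k, ∫ x in cube n c d, |(b x - v x) - k| ≤ Ccut n * ε * d ^ n := by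
  have hs : 1 ≤ √(n : ℝ) := by
    rw [Real.one_le_sqrt]; exact_mod_cast hn
  set s := √(n : ℝ) with hsdef
  set R := 2 * s * R₀ with hRdef
  have hR : 0 < R := by positivity
  have hRs : R / s = 2 * R₀ := by rw [hRdef]; field_simp
  have hR2 : R₀ ≤ R / 2 := by rw [hRdef]; nlinarith
  set m := cubeAvg n b 0 (4 * R) with hm
  have hbm : LocallyIntegrable (fun x => b x - m) volume :=
    hb.sub (locallyIntegrable_const m)
  have hv : LocallyIntegrable (fun x => cutη n R x * (b x - m)) volume := by
    intro x
    obtain ⟨u, hu, hi⟩ := hbm x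
    refine ⟨u, hu, ?_⟩
    apply Integrable.bdd_mul (c := 1) hi cutη_cont.aestronglyMeasurable
    refine Eventually.of_forall fun x => ?_
    rw [Real.norm_eq_abs, abs_of_nonneg cutη_nonneg]; exact cutη_le_one
  refine ⟨fun x => cutη n R x * (b x - m), hv, ?_, ?_⟩
  · apply HasCompactSupport.intro (isCompact_closedBall (0 : Rn n) (2 * R))
    intro x hx
    rw [Metric.mem_closedBall, dist_zero_right, not_le] at hx
    rw [cutη_zero hR hx.le, zero_mul]
  intro c d hd
  have hdn : 0 < d ^ n := by positivity
  have hC1 : 1 + (4 * s) ^ n ≤ Ccut n := by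
    unfold Ccut; rw [← hsdef]
    have : 0 ≤ s * (20 * 2 ^ n + 5 ^ n) := by positivity
    linarith
  have hC2 : 1 + s * (20 * 2 ^ n + 5 ^ n) ≤ Ccut n := by
    unfold Ccut; rw [← hsdef]
    have : 0 ≤ (4 * s) ^ n := by positivity
    linarith
  have hC0 : 0 ≤ Ccut n := by
    have : 0 ≤ (4 * s) ^ n := by positivity
    linarith
  have hbv : IntegrableOn (fun x => b x - cutη n R x * (b x - m)) (cube n c d) volume :=
    (LI.cube hb c hd).sub (LI.cube hv c hd)
  have hob := osc_mul b c hd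
  by_cases hA : ∀ x ∈ cube n c d, ‖x‖ ≤ R
  · refine ⟨m, ?_⟩
    have : ∫ x in cube n c d, |b x - cutη n R x * (b x - m) - m| = ∫ x in cube n c d, (0:ℝ) := by
      apply setIntegral_congr_fun (measurableSet_cube n c d)
      intro x hx
      simp only
      rw [cutη_one hR (hA x hx)]; simp
    rw [this]; simp; positivity
  push Not at hA
  obtain ⟨x0, hx0, hx0R⟩ := hA
  by_cases hB : R / s ≤ d
  · refine ⟨cubeAvg n b c d, ?_⟩
    have ho : osc n b c d ≤ ε := H c d hd (Or.inr (by linarith))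
    have hvn : ∫ x in cube n c d, |cutη n R x * (b x - m)| ≤ ε * (4 * R) ^ n := by
      calc ∫ x in cube n c d, |cutη n R x * (b x - m)|
          ≤ ∫ x in cube n c d, (cube n 0 (4 * R)).indicator (fun x => |b x - m|) x := by
            apply integral_mono (LI.cube hv c hd).abs
            · apply IntegrableOn.integrable
              exact ((IOn.abs_sub (by positivity) (LI.cube hb 0 (by positivity)) m).integrable_indicator (measurableSet_cube _ _ _)).integrableOn
            intro x
            simp only
            by_cases hx : x ∈ cube n 0 (4 * R)
            · rw [indicator_of_mem hx, abs_mul, abs_of_nonneg cutη_nonneg]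
              exact mul_le_of_le_one_left (abs_nonneg _) cutη_le_one
            · rw [indicator_of_notMem hx]
              have : 2 * R ≤ ‖x‖ := by
                by_contra hcon
                exact hx (mem_cube_of_norm (by rw [sub_zero]; linarith))
              rw [cutη_zero hR this]; simp
        _ ≤ ∫ x, (cube n 0 (4 * R)).indicator (fun x => |b x - m|) x := by
            apply setIntegral_le_integral
            · exact ((IOn.abs_sub (by positivity) (LI.cube hb 0 (by positivity)) m).integrable_indicator (measurableSet_cube _ _ _))
            · exact Eventually.of_forall fun x => indicator_nonneg (fun _ _ => abs_nonneg _) _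
        _ = ∫ x in cube n 0 (4 * R), |b x - m| := integral_indicator (measurableSet_cube _ _ _)
        _ = osc n b 0 (4 * R) * (4 * R) ^ n := (osc_mul b 0 (by positivity)).symm
        _ ≤ ε * (4 * R) ^ n := by
            gcongr
            exact H 0 _ (by positivity) (Or.inr (by linarith))
    have h4 : (4 * R) ^ n ≤ (4 * s) ^ n * d ^ n := by
      rw [← mul_pow]
      gcongr ?_ ^ n
      rw [div_le_iff₀ (by positivity)] at hB
      nlinarith
    calc ∫ x in cube n c d, |b x - cutη n R x * (b x - m) - cubeAvg n b c d|
        ≤ ∫ x in cube n c d, (|b x - cubeAvg n b c d| + |cutη n R x * (b x - m)|) := by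
          apply integral_mono (IOn.abs_sub hd hbv _)
            ((IOn.abs_sub hd (LI.cube hb c hd) _).add (LI.cube hv c hd).abs)
          intro x
          simp only [Pi.add_apply]
          have := abs_sub (b x - cubeAvg n b c d) (cutη n R x * (b x - m))
          convert! this using 2
          ring
      _ = osc n b c d * d ^ n + ∫ x in cube n c d, |cutη n R x * (b x - m)| := by
          rw [integral_add (IOn.abs_sub hd (LI.cube hb c hd) _) (LI.cube hv c hd).abs, hob]
      _ ≤ ε * d ^ n + ε * ((4 * s) ^ n * d ^ n) := by
          gcongr
          exact hvn.trans (by gcongr)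
      _ = (1 + (4 * s) ^ n) * ε * d ^ n := by ring
      _ ≤ _ := by gcongr
  · push Not at hB
    have hsd : s * d < R := by rw [lt_div_iff₀ (by positivity)] at hB; linarith
    have hcR : R / 2 ≤ ‖c‖ := by
      have h1 := norm_sub_le_of_mem_cube hd hx0
      have h2 : ‖x0‖ ≤ ‖x0 - c‖ + ‖c‖ := by simpa using norm_add_le (x0 - c) c
      linarith
    have hH : ∀ d', 0 < d' → osc n b c d' ≤ ε := fun d' hd' => H c d' hd' (Or.inl (by linarith))
    set a := cubeAvg n b c d with ha
    have key : ∀ x ∈ cube n c d, |cutη n R c - cutη n R x| * |a - m| ≤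
        s * (20 * 2 ^ n + 5 ^ n) * ε := by
      intro x hx
      have h1 := norm_sub_le_of_mem_cube hd hx
      by_cases hc3 : ‖c‖ ≤ 3 * R
      · have hdR : d ≤ R := by nlinarith
        have h2 := avg_compare hb hε hd hdR hc3 hH
        rw [← ha, ← hm] at h2
        have h3 := cutη_lip hR c x
        rw [norm_sub_rev] at h3
        have h4 : |cutη n R c - cutη n R x| ≤ s * d / R :=
          h3.trans (by gcongr; linarith [show 0 ≤ s * d by positivity])
        calc |cutη n R c - cutη n R x| * |a - m| ≤ (s * d / R) * |a - m| := by gcongr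
          _ = s / R * (|a - m| * d) := by ring
          _ ≤ s / R * ((20 * 2 ^ n + 5 ^ n) * ε * R) := by gcongr
          _ = _ := by field_simp
      · push Not at hc3
        have h2 : ‖c‖ ≤ ‖x - c‖ + ‖x‖ := by
          have := norm_sub_le x (x - c)
          simp at this; linarith
        rw [cutη_zero hR (by linarith), cutη_zero hR (by linarith)]
        simp; positivity
    refine ⟨m + (1 - cutη n R c) * (a - m), ?_⟩
    calc ∫ x in cube n c d, |b x - cutη n R x * (b x - m) - (m + (1 - cutη n R c) * (a - m))|
        ≤ ∫ x in cube n c d, (|b x - a| + s * (20 * 2 ^ n + 5 ^ n) * ε) := by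
          apply setIntegral_mono_on (IOn.abs_sub hd hbv _)
            ((IOn.abs_sub hd (LI.cube hb c hd) _).add (integrableOn_const_cube c hd _))
            (measurableSet_cube n c d)
          intro x hx
          have h1 : b x - cutη n R x * (b x - m) - (m + (1 - cutη n R c) * (a - m)) =
            (1 - cutη n R x) * (b x - a) + (cutη n R c - cutη n R x) * (a - m) := by ring
          rw [h1]
          refine (abs_add_le _ _).trans ?_
          rw [abs_mul, abs_mul]
          have h2 : |1 - cutη n R x| ≤ 1 := by
            rw [abs_of_nonneg (by linarith [cutη_le_one (n := n) (R := R) (x := x)])]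
            linarith [cutη_nonneg (n := n) (R := R) (x := x)]
          exact add_le_add (mul_le_of_le_one_left (abs_nonneg _) h2) (key x hx)
      _ = osc n b c d * d ^ n + s * (20 * 2 ^ n + 5 ^ n) * ε * d ^ n := by
          rw [integral_add (IOn.abs_sub hd (LI.cube hb c hd) _) (integrableOn_const_cube c hd _),
            setIntegral_const_cube c hd, hob]
      _ ≤ ε * d ^ n + s * (20 * 2 ^ n + 5 ^ n) * ε * d ^ n := by
          gcongr; exact hH d hd
      _ = (1 + s * (20 * 2 ^ n + 5 ^ n)) * ε * d ^ n := by ring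
      _ ≤ _ := by gcongr

end cutoff

section mollify

lemma tonelli_cubes {n : ℕ} {w : Rn n → ℝ} (hw : LocallyIntegrable w volume) {t K : ℝ}
    (ht : 0 < t) (hK : 0 ≤ K)
    (H : ∀ u : Rn n, ∫ x in cube n u t, |w x| ≤ K * t ^ n) (c : Rn n) {d : ℝ} (hd : t ≤ d) :
    ∫ x in cube n c d, |w x| ≤ 2 ^ n * K * d ^ n := by
  have hd0 : 0 < d := ht.trans_le hd
  have hconv : ∀ (u : Rn n) (r : ℝ), 0 < r →
      ENNReal.ofReal (∫ x in cube n u r, |w x|) = ∫⁻ x in cube n u r, ‖w x‖ₑ := by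
    intro u r hr
    exact ofReal_integral_norm_eq_lintegral_enorm (LI.cube hw u hr)
  have hWm : AEMeasurable (fun x => ‖w x‖ₑ) volume := hw.aestronglyMeasurable.enorm
  set S : Set (Rn n × Rn n) := {z | z.1 ∈ cube n z.2 t} with hS
  have hSm : MeasurableSet S := by
    apply IsClosed.measurableSet
    have : S = ⋂ i : Fin n, {z : Rn n × Rn n | |z.1 i - z.2 i| ≤ t / 2} := by
      ext z; simp [hS, cube]
    rw [this]
    apply isClosed_iInter
    intro i
    exact isClosed_le (by fun_prop) continuous_const
  have main : (∫⁻ x in cube n c d, ‖w x‖ₑ) * ENNReal.ofReal (t ^ n) ≤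
      ENNReal.ofReal (K * t ^ n) * ENNReal.ofReal ((2 * d) ^ n) := by
    calc (∫⁻ x in cube n c d, ‖w x‖ₑ) * ENNReal.ofReal (t ^ n)
        = ∫⁻ x in cube n c d, ‖w x‖ₑ * ENNReal.ofReal (t ^ n) := by
          rw [lintegral_mul_const' _ _ ENNReal.ofReal_ne_top]
      _ ≤ ∫⁻ x in cube n c d, ∫⁻ u in cube n c (2 * d), ‖w x‖ₑ * S.indicator 1 (x, u) := by
          apply setLIntegral_mono' (measurableSet_cube n c d)
          intro x hx
          rw [lintegral_const_mul' _ _ enorm_ne_top]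
          gcongr
          have h1 : ∀ u : Rn n, S.indicator (1 : Rn n × Rn n → ℝ≥0∞) (x, u) =
              (cube n x t).indicator 1 u := by
            intro u
            by_cases h : x ∈ cube n u t
            · rw [indicator_of_mem (show (x, u) ∈ S from h),
                indicator_of_mem (mem_cube_comm.1 h)]; rfl
            · rw [indicator_of_notMem (show (x, u) ∉ S from h),
                indicator_of_notMem (fun h' => h (mem_cube_comm.1 h'))]
          simp_rw [h1]
          rw [lintegral_indicator_one (measurableSet_cube n x t),
            Measure.restrict_apply (measurableSet_cube n x t), inter_eq_left.2, volume_cube n x t ht]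
          intro u hu i
          have h2 := hu i
          have h3 := hx i
          have h4 := abs_sub_le (u i) (x i) (c i)
          linarith
      _ = ∫⁻ u in cube n c (2 * d), ∫⁻ x in cube n c d, ‖w x‖ₑ * S.indicator 1 (x, u) := by
          apply lintegral_lintegral_swap
          apply AEMeasurable.mul
          · exact hWm.restrict.comp_quasiMeasurePreserving Measure.quasiMeasurePreserving_fst
          · exact (measurable_one.indicator hSm).aemeasurable
      _ ≤ ∫⁻ u in cube n c (2 * d), ENNReal.ofReal (K * t ^ n) := by
          apply lintegral_mono
          intro u
          calc ∫⁻ x in cube n c d, ‖w x‖ₑ * S.indicator 1 (x, u)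
              ≤ ∫⁻ x, ‖w x‖ₑ * S.indicator 1 (x, u) := setLIntegral_le_lintegral _ _
            _ = ∫⁻ x, (cube n u t).indicator (fun x => ‖w x‖ₑ) x := by
                congr 1; ext x
                by_cases h : x ∈ cube n u t
                · rw [indicator_of_mem (show (x, u) ∈ S from h), indicator_of_mem h]; simp
                · rw [indicator_of_notMem (show (x, u) ∉ S from h), indicator_of_notMem h]; simp
            _ = ∫⁻ x in cube n u t, ‖w x‖ₑ := lintegral_indicator (measurableSet_cube n u t) _
            _ ≤ ENNReal.ofReal (K * t ^ n) := by
                rw [← hconv u t ht]; exact ENNReal.ofReal_le_ofReal (H u)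
      _ = _ := by
          rw [setLIntegral_const, volume_cube n c (2 * d) (by positivity)]
  rw [← hconv c d hd0, ← ENNReal.ofReal_mul (by positivity), ← ENNReal.ofReal_mul (by positivity),
    ENNReal.ofReal_le_ofReal_iff (by positivity)] at main
  apply le_of_mul_le_mul_right _ (show 0 < t ^ n by positivity)
  calc _ ≤ _ := main
    _ = _ := by rw [mul_pow]; ring

noncomputable def Cmol (n : ℕ) : ℝ := 2 ^ n * (3 ^ n + (3 * √n) ^ n)

open scoped Convolution in
lemma mollify_lemma {n : ℕ} (hn : 0 < n) {v : Rn n → ℝ} (hv : LocallyIntegrable v volume)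
    (hvc : HasCompactSupport v) {ε a : ℝ} (hε : 0 ≤ ε) (ha : 0 < a)
    (H : ∀ (c : Rn n) (d : ℝ), 0 < d → d ≤ a → ∃ k, ∫ x in cube n c d, |v x - k| ≤ ε * d ^ n) :
    ∃ φ : Rn n → ℝ, ContDiff ℝ (⊤ : ℕ∞) φ ∧ HasCompactSupport φ ∧
      ∀ (c : Rn n) (d : ℝ), 0 < d →
        ∃ k, ∫ x in cube n c d, |(v x - φ x) - k| ≤ Cmol n * ε * d ^ n := by
  have hs : 0 < √(n : ℝ) := by
    rw [Real.sqrt_pos]; exact_mod_cast hn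
  set s := √(n : ℝ) with hsdef
  set t := a / 3 with ht
  have ht0 : 0 < t := by positivity
  let ρ : ContDiffBump (0 : Rn n) := ⟨t / 2, t, by positivity, by linarith⟩
  set r := ρ.normed volume with hr
  have hrb : ∀ x, r x ≤ s ^ n / t ^ n := by
    intro x
    have h1 := ρ.normed_le_div_measure_closedBall_rIn volume x
    refine h1.trans ?_
    have h2 : (t / s) ^ n ≤ volume.real (Metric.closedBall (0 : Rn n) ρ.rIn) := by
      rw [← volume_real_cube n 0 (t / s) (by positivity)]
      apply measureReal_mono
      · intro x hx
        have := norm_sub_le_of_mem_cube (by positivity) hx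
        rw [Metric.mem_closedBall, dist_eq_norm]
        refine this.trans (le_of_eq ?_)
        change s * (t / s) / 2 = t / 2
        field_simp
      · exact measure_closedBall_lt_top.ne
    calc 1 / volume.real (Metric.closedBall (0 : Rn n) ρ.rIn) ≤ 1 / (t / s) ^ n := by gcongr
      _ = _ := by rw [div_pow]; field_simp
  have hr0 : ∀ x, 0 ≤ r x := fun x => ρ.nonneg_normed x
  have hrz : ∀ x, t ≤ ‖x‖ → r x = 0 := by
    intro x hx
    by_contra hne
    have : x ∈ Function.support r := hne
    rw [hr, ρ.support_normed_eq] at this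
    rw [Metric.mem_ball, dist_zero_right] at this
    exact absurd this (not_lt.2 hx)
  have hrc : Continuous r := ρ.continuous_normed
  have hvi : Integrable v volume := by
    have := hv.integrableOn_isCompact hvc
    rwa [integrableOn_iff_integrable_of_support_subset (subset_tsupport v)] at this
  set φ := r ⋆[ContinuousLinearMap.lsmul ℝ ℝ, volume] v with hφ
  have hφsm : ContDiff ℝ (⊤ : ℕ∞) φ :=
    ρ.hasCompactSupport_normed.contDiff_convolution_left _ ρ.contDiff_normed hv
  have hφcs : HasCompactSupport φ :=
    HasCompactSupport.convolution _ ρ.hasCompactSupport_normed hvc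
  have hφx : ∀ x, φ x = ∫ y, r (x - y) * v y := by
    intro x
    rw [hφ, convolution_eq_swap]
    rfl
  have hφl : LocallyIntegrable φ volume := hφsm.continuous.locallyIntegrable
  have hpt : ∀ (u : Rn n) (k : ℝ), (∫ x in cube n u (3 * t), |v x - k| ≤ ε * (3 * t) ^ n) →
      ∀ x ∈ cube n u t, |φ x - k| ≤ (3 * s) ^ n * ε := by
    intro u k hk x hx
    have hri : Integrable (fun y => r (x - y)) volume :=
      (ρ.integrable_normed (μ := volume)).comp_sub_left x
    have h1 : ∫ y, r (x - y) = 1 := by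
      rw [integral_sub_left_eq_self r volume x]; exact ρ.integral_normed
    have hrvi : Integrable (fun y => r (x - y) * v y) volume := by
      apply Integrable.bdd_mul (c := s ^ n / t ^ n) hvi
        (hrc.comp (continuous_const.sub continuous_id)).aestronglyMeasurable
      refine Eventually.of_forall fun y => ?_
      change |r (x - y)| ≤ _
      rw [abs_of_nonneg (hr0 _)]; exact hrb _
    have h2 : φ x - k = ∫ y, r (x - y) * (v y - k) := by
      simp_rw [mul_sub]
      rw [integral_sub hrvi (hri.mul_const k), integral_mul_const, h1, one_mul, hφx]
    have hI : Integrable (fun y => r (x - y) * (v y - k)) volume := by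
      simp_rw [mul_sub]; exact hrvi.sub (hri.mul_const k)
    have hQ : IntegrableOn (fun x => |v x - k|) (cube n u (3 * t)) volume :=
      IOn.abs_sub (by positivity) hvi.integrableOn k
    calc |φ x - k| ≤ ∫ y, |r (x - y) * (v y - k)| := by
          rw [h2]; exact abs_integral_le_integral_abs
      _ ≤ ∫ y, (cube n u (3 * t)).indicator (fun y => s ^ n / t ^ n * |v y - k|) y := by
          apply integral_mono hI.abs (IntegrableOn.integrable_indicator (hQ.const_mul _) (measurableSet_cube _ _ _))
          intro y
          simp only
          rw [abs_mul, abs_of_nonneg (hr0 _)]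
          by_cases hy : y ∈ cube n u (3 * t)
          · rw [indicator_of_mem hy]
            gcongr
            exact hrb _
          · rw [indicator_of_notMem hy, hrz, zero_mul]
            by_contra hcon
            push Not at hcon
            apply hy
            intro i
            have h3 := hx i
            have h4 := PiLp.norm_apply_le (x - y) i
            rw [Real.norm_eq_abs] at h4
            simp only [PiLp.sub_apply] at h4
            have h5 := abs_sub_le (y i) (x i) (u i)
            rw [abs_sub_comm (y i) (x i)] at h5
            linarith
      _ = s ^ n / t ^ n * ∫ y in cube n u (3 * t), |v y - k| := by
          rw [integral_indicator (measurableSet_cube _ _ _), integral_const_mul]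
      _ ≤ s ^ n / t ^ n * (ε * (3 * t) ^ n) := by gcongr
      _ = _ := by rw [mul_pow, mul_pow]; field_simp
  have h3t : 3 * t = a := by rw [ht]; ring
  have hp1 : (1:ℝ) ≤ 2 ^ n := one_le_pow₀ (by norm_num)
  have hp2 : (1:ℝ) ≤ 3 ^ n := one_le_pow₀ (by norm_num)
  have hp3 : 0 ≤ (3 * s) ^ n := by positivity
  refine ⟨φ, hφsm, hφcs, ?_⟩
  intro c d hd
  by_cases hdt : d ≤ t
  · obtain ⟨k1, hk1⟩ := H c d hd (by linarith)
    obtain ⟨k2, hk2⟩ := H c (3 * t) (by positivity) h3t.le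
    refine ⟨k1 - k2, ?_⟩
    calc ∫ x in cube n c d, |(v x - φ x) - (k1 - k2)|
        ≤ ∫ x in cube n c d, (|v x - k1| + (3 * s) ^ n * ε) := by
          apply setIntegral_mono_on
            (IOn.abs_sub hd ((LI.cube hv c hd).sub (LI.cube hφl c hd)) _)
            ((IOn.abs_sub hd (LI.cube hv c hd) _).add (integrableOn_const_cube c hd _))
            (measurableSet_cube n c d)
          intro x hx
          have h1 := hpt c k2 hk2 x (cube_mono hdt hx)
          have h2 := abs_sub (v x - k1) (φ x - k2)
          have h3 : v x - φ x - (k1 - k2) = (v x - k1) - (φ x - k2) := by ring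
          change |v x - φ x - (k1 - k2)| ≤ |v x - k1| + (3 * s) ^ n * ε
          rw [h3]; linarith
      _ = (∫ x in cube n c d, |v x - k1|) + (3 * s) ^ n * ε * d ^ n := by
          rw [integral_add (IOn.abs_sub hd (LI.cube hv c hd) _) (integrableOn_const_cube c hd _),
            setIntegral_const_cube c hd]
      _ ≤ ε * d ^ n + (3 * s) ^ n * ε * d ^ n := by gcongr
      _ = (1 + (3 * s) ^ n) * ε * d ^ n := by ring
      _ ≤ Cmol n * ε * d ^ n := by
          gcongr
          unfold Cmol
          rw [← hsdef]
          nlinarith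
  · push Not at hdt
    refine ⟨0, ?_⟩
    have hw : LocallyIntegrable (fun x => v x - φ x) volume := hv.sub hφl
    have := tonelli_cubes hw ht0 (K := (3 ^ n + (3 * s) ^ n) * ε) (by positivity) ?_ c hdt.le
    · simp only [sub_zero]
      refine this.trans (le_of_eq ?_)
      unfold Cmol
      rw [← hsdef]; ring
    intro u
    obtain ⟨k2, hk2⟩ := H u (3 * t) (by positivity) h3t.le
    calc ∫ x in cube n u t, |v x - φ x|
        ≤ ∫ x in cube n u t, (|v x - k2| + (3 * s) ^ n * ε) := by
          apply setIntegral_mono_on (LI.cube hw u ht0).abs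
            ((IOn.abs_sub ht0 (LI.cube hv u ht0) _).add (integrableOn_const_cube u ht0 _))
            (measurableSet_cube n u t)
          intro x hx
          have h1 := hpt u k2 hk2 x hx
          have h2 := abs_sub (v x - k2) (φ x - k2)
          have h3 : v x - φ x = (v x - k2) - (φ x - k2) := by ring
          change |v x - φ x| ≤ |v x - k2| + (3 * s) ^ n * ε
          rw [h3]; linarith
      _ = (∫ x in cube n u t, |v x - k2|) + (3 * s) ^ n * ε * t ^ n := by
          rw [integral_add (IOn.abs_sub ht0 (LI.cube hv u ht0) _) (integrableOn_const_cube u ht0 _),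
            setIntegral_const_cube u ht0]
      _ ≤ (∫ x in cube n u (3 * t), |v x - k2|) + (3 * s) ^ n * ε * t ^ n := by
          have h3t0 : 0 < 3 * t := by positivity
          have := setIntegral_mono_set (IOn.abs_sub h3t0 (LI.cube hv u h3t0) k2)
            (Eventually.of_forall fun x => abs_nonneg _)
            (cube_mono (n := n) (c := u) (show t ≤ 3 * t by linarith)).eventuallyLE
          linarith
      _ ≤ ε * (3 * t) ^ n + (3 * s) ^ n * ε * t ^ n := by gcongr
      _ = _ := by rw [mul_pow 3 t]; ring

lemma memCMO_of {n : ℕ} (hn : 0 < n) {b : Rn n → ℝ} (hb : LocallyIntegrable b volume)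
    (H : ∀ ε : ℝ, 0 < ε → ∃ N : ℝ, 0 < N ∧ ∀ (c : Rn n) (d : ℝ), 0 < d →
      (d ≤ 1 / N ∨ N ≤ ‖c‖ ∨ N ≤ d) → osc n b c d ≤ ε) : MemCMO n b := by
  intro ε hε
  have hs : 0 ≤ √(n : ℝ) := Real.sqrt_nonneg _
  have hC1 : 0 ≤ Ccut n := by unfold Ccut; positivity
  have hC2 : 0 ≤ Cmol n := by unfold Cmol; positivity
  set M := 2 * (Ccut n + Cmol n * (1 + Ccut n)) + 1 with hM
  have hM0 : 0 < M := by positivity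
  set δ := ε / (2 * M) with hδ
  have hδ0 : 0 < δ := by positivity
  obtain ⟨N, hN0, hN⟩ := H δ hδ0
  obtain ⟨v, hv, hvc, hvb⟩ := cutoff_lemma hn hb hδ0.le hN0
    (fun c d hd h => hN c d hd (Or.inr h))
  obtain ⟨φ, hφ, hφc, hφb⟩ := mollify_lemma hn hv hvc (ε := (1 + Ccut n) * δ) (a := 1 / N)
    (by positivity) (by positivity) (by
      intro c d hd hda
      obtain ⟨k, hk⟩ := hvb c d hd
      refine ⟨cubeAvg n b c d - k, ?_⟩
      have ho := osc_mul b c hd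
      have ho2 := hN c d hd (Or.inl hda)
      have hbv : IntegrableOn (fun x => b x - v x) (cube n c d) volume :=
        (LI.cube hb c hd).sub (LI.cube hv c hd)
      calc ∫ x in cube n c d, |v x - (cubeAvg n b c d - k)|
          ≤ ∫ x in cube n c d, (|b x - cubeAvg n b c d| + |(b x - v x) - k|) := by
            apply integral_mono (IOn.abs_sub hd (LI.cube hv c hd) _)
              ((IOn.abs_sub hd (LI.cube hb c hd) _).add (IOn.abs_sub hd hbv _))
            intro x
            have h2 := abs_sub (b x - cubeAvg n b c d) (b x - v x - k)
            have h3 : v x - (cubeAvg n b c d - k) =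
              (b x - cubeAvg n b c d) - (b x - v x - k) := by ring
            simp only [Pi.add_apply]
            rw [h3]; exact h2
        _ = osc n b c d * d ^ n + ∫ x in cube n c d, |(b x - v x) - k| := by
            rw [integral_add (IOn.abs_sub hd (LI.cube hb c hd) _) (IOn.abs_sub hd hbv _), ho]
        _ ≤ δ * d ^ n + Ccut n * δ * d ^ n := by gcongr
        _ = _ := by ring)
  refine ⟨φ, hφ, hφc, ?_⟩
  have hφl : LocallyIntegrable φ volume := hφ.continuous.locallyIntegrable
  have hall : ∀ (c : Rn n) (d : ℝ), 0 < d → osc n (b - φ) c d ≤ ε / 2 := by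
    intro c d hd
    obtain ⟨k1, hk1⟩ := hvb c d hd
    obtain ⟨k2, hk2⟩ := hφb c d hd
    have hbv := (LI.cube hb c hd).sub (LI.cube hv c hd)
    have hvφ := (LI.cube hv c hd).sub (LI.cube hφl c hd)
    have := osc_le_of (w := b - φ) hd (hb.sub hφl) (k1 + k2)
      (Ccut n * δ + Cmol n * ((1 + Ccut n) * δ)) (by
        calc ∫ x in cube n c d, |(b - φ) x - (k1 + k2)|
            ≤ ∫ x in cube n c d, (|(b x - v x) - k1| + |(v x - φ x) - k2|) := by
              apply integral_mono (IOn.abs_sub hd ((LI.cube hb c hd).sub (LI.cube hφl c hd)) _)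
                ((IOn.abs_sub hd hbv _).add (IOn.abs_sub hd hvφ _))
              intro x
              have h2 := abs_add_le (b x - v x - k1) (v x - φ x - k2)
              have h3 : (b - φ) x - (k1 + k2) = (b x - v x - k1) + (v x - φ x - k2) := by
                simp only [Pi.sub_apply]; ring
              simp only [Pi.add_apply]
              rw [h3]; exact h2
          _ = _ := integral_add (IOn.abs_sub hd hbv _) (IOn.abs_sub hd hvφ _)
          _ ≤ Ccut n * δ * d ^ n + Cmol n * ((1 + Ccut n) * δ) * d ^ n := add_le_add hk1 hk2
          _ = _ := by ring)
    refine this.trans ?_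
    have h1 : 2 * (Ccut n * δ + Cmol n * ((1 + Ccut n) * δ)) = (M - 1) * δ := by rw [hM]; ring
    have h2 : M * δ = ε / 2 := by rw [hδ]; field_simp
    rw [h1]; linarith
  have : bmoNorm n (b - φ) ≤ ε / 2 := by
    have : Nonempty (Rn n × {d : ℝ // 0 < d}) := ⟨(0, ⟨1, one_pos⟩)⟩
    exact ciSup_le fun cd => hall cd.1 cd.2.1 cd.2.2
  linarith

end mollify

section norms

lemma wNorm_eq {n : ℕ} {q : ℝ} (hq : 0 < q) (f : Rn n → ℝ) :
    wNorm n q (fun _ => 1) f = eLpNorm f (ENNReal.ofReal q) volume := by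
  rw [eLpNorm_eq_lintegral_rpow_enorm_toReal (by simpa using hq) ENNReal.ofReal_ne_top,
    ENNReal.toReal_ofReal hq.le, wNorm]
  congr 2
  ext x
  rw [mul_one, ← ENNReal.ofReal_rpow_of_nonneg (abs_nonneg _) hq.le, ← Real.norm_eq_abs,
    ofReal_norm]

lemma wNorm_testG {n : ℕ} {p : ℝ} (hp : 0 < p) (c : Rn n) {d : ℝ} (hd : 0 < d) :
    wNorm n p (fun _ => 1) (testG n p c d) ≤ 1 := by
  have hV : 0 < d ^ n := by positivity
  have h : ∀ x, ENNReal.ofReal (|testG n p c d x| ^ p * 1) =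
      (cube n c d).indicator (fun _ => ENNReal.ofReal ((d ^ n)⁻¹)) x := by
    intro x
    by_cases hx : x ∈ cube n c d
    · rw [testG, indicator_of_mem hx, indicator_of_mem hx, mul_one,
        abs_of_nonneg (by positivity), ← Real.rpow_mul hV.le]
      congr 1
      rw [← Real.rpow_neg_one]
      congr 1
      field_simp
    · rw [testG, indicator_of_notMem hx, indicator_of_notMem hx, abs_zero,
        Real.zero_rpow hp.ne']
      simp
  rw [wNorm]
  simp_rw [h]
  rw [lintegral_indicator (measurableSet_cube _ _ _), setLIntegral_const, volume_cube n c d hd,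
    ← ENNReal.ofReal_mul (by positivity), inv_mul_cancel₀ hV.ne']
  simp

lemma measurable_testG {n : ℕ} {p : ℝ} (c : Rn n) {d : ℝ} : Measurable (testG n p c d) :=
  measurable_const.indicator (measurableSet_cube _ _ _)

lemma measurable_fracKernel (n : ℕ) (α : ℝ) :
    Measurable (fun w : (Rn n × Rn n) × Rn n => fracKernel n α w.1.1 w.1.2 w.2) := by
  unfold fracKernel
  fun_prop

lemma Iop_stronglyMeasurable {n : ℕ} {α : ℝ} {u g : Rn n → ℝ} (hu : Measurable u)
    (hg : Measurable g) : StronglyMeasurable (Iop n α u g) := by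
  have h1 : StronglyMeasurable (fun w : (Rn n × Rn n) × Rn n =>
      fracKernel n α w.1.1 w.1.2 w.2 * (u w.1.2 * g w.2)) := by
    apply Measurable.stronglyMeasurable
    exact (measurable_fracKernel n α).mul
      ((hu.comp (measurable_snd.comp measurable_fst)).mul (hg.comp measurable_snd))
  have h2 := h1.integral_prod_right' (ν := (volume : Measure (Rn n)))
  exact h2.integral_prod_right' (ν := (volume : Measure (Rn n)))

lemma commI_aesm {n : ℕ} {α : ℝ} {b f g : Rn n → ℝ} (hb : AEStronglyMeasurable b volume)
    (hf : Measurable f) (hg : Measurable g) :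
    AEStronglyMeasurable (commI n α b f g) volume := by
  have h1 : Iop n α (fun y => b y * f y) g = Iop n α (fun y => hb.mk b y * f y) g := by
    ext x
    unfold Iop
    apply integral_congr_ae
    filter_upwards [hb.ae_eq_mk] with y hy
    simp only [← hy]
  unfold commI
  rw [h1]
  exact (Iop_stronglyMeasurable (hb.stronglyMeasurable_mk.measurable.mul hf)
    hg).aestronglyMeasurable.sub (hb.mul (Iop_stronglyMeasurable hf hg).aestronglyMeasurable)

lemma commI_smul {n : ℕ} {α : ℝ} (b f g : Rn n → ℝ) (a : ℝ) (x : Rn n) :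
    commI n α b (fun y => a * f y) g x = a * commI n α b f g x := by
  have h : ∀ u : Rn n → ℝ, Iop n α (fun y => a * u y) g x = a * Iop n α u g x := by
    intro u
    unfold Iop
    rw [← integral_const_mul]
    congr 1; ext y
    rw [← integral_const_mul]
    congr 1; ext z
    ring
  unfold commI
  have h2 : (fun y => b y * (a * f y)) = fun y => a * (b y * f y) := by ext y; ring
  rw [h2, h, h]; ring

lemma commI_memLp {n : ℕ} {α p₁ p₂ q : ℝ} (hp₁ : 1 < p₁) (hp₂ : 1 < p₂) (hq : 1 < q)
    {b : Rn n → ℝ} (hb : LocallyIntegrable b volume)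
    (hcpt : BilinCompact n p₁ p₂ q (fun _ => 1) (fun _ => 1) (fun _ => 1) (commI n α b))
    (c c' : Rn n) {d d' : ℝ} (hd : 0 < d) (hd' : 0 < d') :
    MemLp (commI n α b (testG n p₁ c d) (testG n p₂ c' d')) (ENNReal.ofReal q) volume := by
  have hm := commI_aesm (α := α) hb.aestronglyMeasurable (measurable_testG (p := p₁) c (d := d))
    (measurable_testG (p := p₂) c' (d := d'))
  refine ⟨hm, ?_⟩
  set T := commI n α b (testG n p₁ c d) (testG n p₂ c' d') with hT
  have hle : ∀ j : ℕ, wNorm n p₁ (fun _ => 1)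
      (fun y => (1 / ((j : ℝ) + 1)) * testG n p₁ c d y) ≤ 1 := by
    intro j
    have h1 := wNorm_testG (p := p₁) (by linarith) c hd
    rw [wNorm_eq (by linarith)] at h1 ⊢
    refine le_trans (eLpNorm_mono fun x => ?_) h1
    rw [norm_mul]
    apply mul_le_of_le_one_left (norm_nonneg _)
    rw [Real.norm_eq_abs, abs_of_nonneg (by positivity), div_le_one (by positivity)]
    have : (0:ℝ) ≤ j := by positivity
    linarith
  obtain ⟨φ, hφ, hC⟩ := hcpt (fun j y => (1 / ((j : ℝ) + 1)) * testG n p₁ c d y)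
    (fun _ => testG n p₂ c' d') hle (fun _ => wNorm_testG (by linarith) c' hd')
  obtain ⟨N, hN⟩ := hC 1 one_pos
  have h1 := hN N le_rfl (N + 1) (by omega)
  simp only [commI_smul] at h1
  rw [wNorm_eq (by linarith)] at h1
  set a : ℝ := 1 / ((φ N : ℝ) + 1) - 1 / ((φ (N + 1) : ℝ) + 1) with ha
  have ha0 : a ≠ 0 := by
    have : φ N < φ (N + 1) := hφ (by omega)
    have h2 : (φ N : ℝ) < φ (N + 1) := by exact_mod_cast this
    have h3 : 1 / ((φ (N + 1) : ℝ) + 1) < 1 / ((φ N : ℝ) + 1) := by gcongr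
    rw [ha]; linarith
  have h2 : (fun x => 1 / ((φ N : ℝ) + 1) * commI n α b (testG n p₁ c d) (testG n p₂ c' d') x -
      1 / ((φ (N + 1) : ℝ) + 1) * commI n α b (testG n p₁ c d) (testG n p₂ c' d') x) = a • T := by
    ext x
    rw [Pi.smul_apply, smul_eq_mul, ha]; ring
  rw [h2, eLpNorm_const_smul] at h1
  by_contra hcon
  rw [not_lt, top_le_iff] at hcon
  rw [hcon, ENNReal.mul_top (by simpa using ha0)] at h1
  exact absurd h1 (by simp)

lemma holder_cube {n : ℕ} {q : ℝ} (hq : 1 < q) {U : Rn n → ℝ}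
    (hU : MemLp U (ENNReal.ofReal q) volume) (c : Rn n) {d : ℝ} (hd : 0 < d) {η : ℝ} (hη : 0 ≤ η)
    (h : eLpNorm U (ENNReal.ofReal q) volume ≤ ENNReal.ofReal η) :
    IntegrableOn U (cube n c d) volume ∧
      ∫ x in cube n c d, |U x| ≤ η * (d ^ n) ^ (1 - 1 / q) := by
  have hV : 0 < d ^ n := by positivity
  have hq1 : (1 : ℝ≥0∞) ≤ ENNReal.ofReal q := by
    rw [← ENNReal.ofReal_one]; exact ENNReal.ofReal_le_ofReal hq.le
  have : IsFiniteMeasure (volume.restrict (cube n c d)) :=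
    ⟨by rw [Measure.restrict_apply_univ]; exact (volume_cube_ne_top c hd).lt_top⟩
  have hI : IntegrableOn U (cube n c d) volume :=
    (hU.restrict (cube n c d)).integrable hq1
  refine ⟨hI, ?_⟩
  have h1 := eLpNorm_le_eLpNorm_mul_rpow_measure_univ (μ := volume.restrict (cube n c d)) hq1
    hU.1.restrict
  rw [Measure.restrict_apply_univ, volume_cube n c d hd, ENNReal.toReal_ofReal (by linarith),
    ENNReal.toReal_one, eLpNorm_one_eq_lintegral_enorm,
    ← ofReal_integral_norm_eq_lintegral_enorm hI, div_one,
    ENNReal.ofReal_rpow_of_pos hV] at h1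
  have h2 : eLpNorm U (ENNReal.ofReal q) (volume.restrict (cube n c d)) ≤ ENNReal.ofReal η :=
    (eLpNorm_restrict_le _ _ _ _).trans h
  have h3 : ENNReal.ofReal (∫ x in cube n c d, ‖U x‖) ≤
      ENNReal.ofReal (η * (d ^ n) ^ (1 - 1 / q)) := by
    rw [ENNReal.ofReal_mul hη]
    exact h1.trans (by gcongr)
  rwa [ENNReal.ofReal_le_ofReal_iff (by positivity)] at h3

lemma small_pairing {n : ℕ} {q : ℝ} (hq : 1 < q) {T : Rn n → ℝ}
    (hT : MemLp T (ENNReal.ofReal q) volume) {η : ℝ} (hη : 0 < η) :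
    ∃ M R : ℝ, 0 ≤ M ∧ 0 ≤ R ∧ ∀ (c : Rn n) (d : ℝ), 0 < d →
      ∫ x in cube n c d, |T x| ≤ η * (d ^ n) ^ (1 - 1 / q) +
        M * volume.real (cube n c d ∩ Metric.closedBall 0 R) := by
  obtain ⟨g, hgc, hg1, hgcont, hgL⟩ := hT.exists_hasCompactSupport_eLpNorm_sub_le
    ENNReal.ofReal_ne_top (ε := ENNReal.ofReal η) (by simpa using hη)
  obtain ⟨M, hM⟩ := hgcont.bounded_above_of_compact_support hgc
  obtain ⟨R, hR⟩ := hgc.isCompact.isBounded.subset_closedBall (0 : Rn n)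
  refine ⟨max M 0, max R 0, le_max_right _ _, le_max_right _ _, ?_⟩
  intro c d hd
  obtain ⟨h1, h2⟩ := holder_cube hq (hT.sub hgL) c hd hη.le hg1
  have hgi : IntegrableOn g (cube n c d) volume :=
    LI.cube hgcont.locallyIntegrable c hd
  have hTi : IntegrableOn T (cube n c d) volume := by
    have := h1.add hgi
    simpa using this
  have h3 : ∫ x in cube n c d, |g x| ≤
      max M 0 * volume.real (cube n c d ∩ Metric.closedBall 0 (max R 0)) := by
    have hms : MeasurableSet (Metric.closedBall (0 : Rn n) (max R 0)) := measurableSet_closedBall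
    have hI : IntegrableOn ((Metric.closedBall (0 : Rn n) (max R 0)).indicator
        (fun _ => max M 0)) (cube n c d) volume :=
      (integrableOn_const_cube c hd (max M 0)).indicator hms
    calc ∫ x in cube n c d, |g x| ≤
        ∫ x in cube n c d, (Metric.closedBall (0 : Rn n) (max R 0)).indicator
          (fun _ => max M 0) x := by
          apply integral_mono hgi.abs hI
          intro x
          simp only
          by_cases hx : x ∈ Metric.closedBall (0 : Rn n) (max R 0)
          · rw [indicator_of_mem hx]
            exact (hM x).trans (le_max_left _ _)
          · have hg0 : g x = 0 := image_eq_zero_of_notMem_tsupport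
              fun h => hx (Metric.closedBall_subset_closedBall (le_max_left _ _) (hR h))
            rw [indicator_of_notMem hx, hg0, abs_zero]
      _ = _ := by
          rw [setIntegral_indicator hms, setIntegral_const, smul_eq_mul, mul_comm]
  calc ∫ x in cube n c d, |T x| ≤ ∫ x in cube n c d, (|(T - g) x| + |g x|) := by
        apply integral_mono hTi.abs (h1.abs.add hgi.abs)
        intro x
        have := abs_add_le ((T - g) x) (g x)
        simp only [Pi.sub_apply, sub_add_cancel] at this
        exact this
    _ = (∫ x in cube n c d, |(T - g) x|) + ∫ x in cube n c d, |g x| :=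
        integral_add h1.abs hgi.abs
    _ ≤ _ := add_le_add h2 h3

end norms

section lower

lemma kernel_close {n : ℕ} (hn : 0 < n) {β : ℝ} :
    ∃ N : ℝ, 0 < N ∧ ∃ e : Rn n, ∀ (c : Rn n) (d : ℝ), 0 < d → ∀ x ∈ cube n c d,
      ∀ y ∈ cube n c d, ∀ z ∈ cube n (c + (N * d) • e) d,
      |(‖x - y‖ ^ 2 + ‖x - z‖ ^ 2) ^ (-β) - ((N * d) ^ 2) ^ (-β)| ≤
        ((N * d) ^ 2) ^ (-β) / 4 := by
  have hs : 1 ≤ √(n : ℝ) := by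
    rw [Real.one_le_sqrt]; exact_mod_cast hn
  set s := √(n : ℝ) with hsdef
  have hcont : ContinuousAt (fun t : ℝ => t ^ (-β)) 1 :=
    Real.continuousAt_rpow_const _ _ (Or.inl one_ne_zero)
  obtain ⟨δ, hδ, hδ2⟩ := Metric.continuousAt_iff.1 hcont (1 / 4) (by norm_num)
  set N := s + 4 * s / δ + 1 with hN
  have hNs : s ≤ N := by
    have : 0 ≤ 4 * s / δ := by positivity
    linarith
  have hN0 : 0 < N := by linarith
  have hNδ : 4 * s < δ * N := by
    have : δ * (4 * s / δ) = 4 * s := by field_simp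
    rw [hN]; nlinarith
  refine ⟨N, hN0, EuclideanSpace.single ⟨0, hn⟩ 1, ?_⟩
  set e : Rn n := EuclideanSpace.single ⟨0, hn⟩ 1 with he
  have he1 : ‖e‖ = 1 := by rw [he]; simp
  intro c d hd x hx y hy z hz
  have hx1 := norm_sub_le_of_mem_cube hd hx
  have hy1 := norm_sub_le_of_mem_cube hd hy
  have hz1 := norm_sub_le_of_mem_cube hd hz
  have hxy : ‖x - y‖ ≤ s * d := by
    have : x - y = (x - c) - (y - c) := by abel
    rw [this]
    refine (norm_sub_le _ _).trans ?_
    linarith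
  have hNd : 0 < N * d := by positivity
  have hxz : |‖x - z‖ - N * d| ≤ s * d := by
    have h1 : ‖(N * d) • e‖ = N * d := by
      rw [norm_smul, he1, mul_one, Real.norm_eq_abs, abs_of_pos hNd]
    have h2 := abs_norm_sub_norm_le (z - x) ((N * d) • e)
    rw [h1, norm_sub_rev z x] at h2
    refine h2.trans ?_
    have h3 : z - x - (N * d) • e = (z - (c + (N * d) • e)) - (x - c) := by abel
    rw [h3]
    refine (norm_sub_le _ _).trans ?_
    linarith
  set S := ‖x - y‖ ^ 2 + ‖x - z‖ ^ 2 with hS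
  have hS0 : 0 ≤ S := by positivity
  have hSd : |S - (N * d) ^ 2| ≤ 4 * N * s * d ^ 2 := by
    have h1 : S - (N * d) ^ 2 = ‖x - y‖ ^ 2 + 2 * (N * d) * (‖x - z‖ - N * d) +
      (‖x - z‖ - N * d) ^ 2 := by rw [hS]; ring
    have h2 : ‖x - y‖ ^ 2 ≤ (s * d) ^ 2 := by gcongr
    have h3 : (‖x - z‖ - N * d) ^ 2 ≤ (s * d) ^ 2 := by
      rw [← sq_abs]; gcongr
    have h4 : |2 * (N * d) * (‖x - z‖ - N * d)| ≤ 2 * (N * d) * (s * d) := by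
      rw [abs_mul, abs_of_pos (by positivity)]; gcongr
    have h5 : (s * d) ^ 2 ≤ N * s * d ^ 2 := by
      have : (s * d) ^ 2 = s * (s * d ^ 2) := by ring
      rw [this, mul_assoc]; gcongr
    rw [h1]
    refine (abs_add_three _ _ _).trans ?_
    rw [abs_of_nonneg (sq_nonneg ‖x - y‖), abs_of_nonneg (sq_nonneg (‖x - z‖ - N * d))]
    nlinarith
  set τ := S / (N * d) ^ 2 with hτ
  have hτ0 : 0 ≤ τ := by positivity
  have hSτ : S = (N * d) ^ 2 * τ := by rw [hτ]; field_simp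
  have hτ1 : |τ - 1| < δ := by
    have h1 : τ - 1 = (S - (N * d) ^ 2) / (N * d) ^ 2 := by rw [hτ]; field_simp
    rw [h1, abs_div, abs_of_pos (show 0 < (N * d) ^ 2 by positivity), div_lt_iff₀ (by positivity)]
    refine hSd.trans_lt ?_
    have : δ * (N * d) ^ 2 = δ * N * (N * d ^ 2) := by ring
    rw [this]
    have h2 : 4 * N * s * d ^ 2 = 4 * s * (N * d ^ 2) := by ring
    rw [h2]
    gcongr
  have h := hδ2 (x := τ) (by rw [Real.dist_eq]; exact hτ1)
  rw [Real.dist_eq, Real.one_rpow] at h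
  rw [hSτ, Real.mul_rpow (by positivity) hτ0]
  have hk : 0 < ((N * d) ^ 2) ^ (-β) := by positivity
  have h6 : ((N * d) ^ 2) ^ (-β) * τ ^ (-β) - ((N * d) ^ 2) ^ (-β) =
    ((N * d) ^ 2) ^ (-β) * (τ ^ (-β) - 1) := by ring
  rw [h6, abs_mul, abs_of_pos hk]
  nlinarith

lemma Iop_testG {n : ℕ} {α p : ℝ} (u : Rn n → ℝ) (c : Rn n) (d : ℝ) (x : Rn n) :
    Iop n α u (testG n p c d) x =
      ∫ y, u y * ((d ^ n) ^ (-(1 / p)) * ∫ z in cube n c d, fracKernel n α x y z) := by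
  unfold Iop
  congr 1; ext y
  rw [← integral_indicator (measurableSet_cube _ _ _), ← integral_const_mul, ← integral_const_mul]
  congr 1; ext z
  unfold testG
  by_cases hz : z ∈ cube n c d
  · rw [indicator_of_mem hz, indicator_of_mem hz]; ring
  · rw [indicator_of_notMem hz, indicator_of_notMem hz]; ring

lemma comm_pointwise {n : ℕ} {α p₁ p₂ K0 : ℝ} (hK0 : 0 < K0)
    {b : Rn n → ℝ} (hb : LocallyIntegrable b volume) (c c' : Rn n) {d : ℝ} (hd : 0 < d)
    {x : Rn n}
    (hk : ∀ y ∈ cube n c d, ∀ z ∈ cube n c' d, |fracKernel n α x y z - K0| ≤ K0 / 4) :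
    (d ^ n) ^ (-(1 / p₁)) * (d ^ n) ^ (-(1 / p₂)) * K0 * (d ^ n) ^ 2 *
      (3 / 4 * |b x - cubeAvg n b c d| - 1 / 4 * osc n b c d) ≤
      |commI n α b (testG n p₁ c d) (testG n p₂ c' d) x| := by
  set V : ℝ := d ^ n with hV
  have hV0 : 0 < V := by positivity
  set A := V ^ (-(1 / p₁)) with hA
  set B := V ^ (-(1 / p₂)) with hB
  have hA0 : 0 < A := by positivity
  have hB0 : 0 < B := by positivity
  set κ : Rn n → ℝ := fun y => ∫ z in cube n c' d, fracKernel n α x y z with hκ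
  have hmeas : Measurable (fun w : Rn n × Rn n => fracKernel n α x w.1 w.2) := by
    unfold fracKernel; fun_prop
  have hκm : StronglyMeasurable κ :=
    hmeas.stronglyMeasurable.integral_prod_right' (ν := volume.restrict (cube n c' d))
  have hκb : ∀ y ∈ cube n c d, |κ y - K0 * V| ≤ K0 * V / 4 := by
    intro y hy
    have hm1 : Measurable (fun z => fracKernel n α x y z) := by
      unfold fracKernel; fun_prop
    have hi : IntegrableOn (fun z => fracKernel n α x y z) (cube n c' d) volume := by
      apply Measure.integrableOn_of_bounded (M := 2 * K0) (volume_cube_ne_top c' hd)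
        hm1.aestronglyMeasurable
      rw [ae_restrict_iff' (measurableSet_cube _ _ _)]
      refine Eventually.of_forall fun z hz => ?_
      have := abs_le.1 (hk y hy z hz)
      rw [Real.norm_eq_abs, abs_le]
      constructor <;> linarith
    have h1 : κ y - K0 * V = ∫ z in cube n c' d, (fracKernel n α x y z - K0) := by
      rw [integral_sub hi (integrableOn_const_cube c' hd K0), setIntegral_const_cube c' hd]
    rw [h1]
    have h2 := norm_setIntegral_le_of_norm_le_const (μ := volume) (s := cube n c' d)
      (f := fun z => fracKernel n α x y z - K0) (C := K0 / 4) (volume_cube_ne_top c' hd).lt_top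
      (fun z hz => hk y hy z hz)
    rw [volume_real_cube n c' d hd, Real.norm_eq_abs] at h2
    refine h2.trans (le_of_eq ?_)
    ring
  have hκbd : ∀ᵐ y ∂(volume.restrict (cube n c d)), ‖κ y‖ ≤ 2 * (K0 * V) := by
    rw [ae_restrict_iff' (measurableSet_cube _ _ _)]
    refine Eventually.of_forall fun z hz => ?_
    have := abs_le.1 (hκb z hz)
    have h0 : 0 < K0 * V := by positivity
    rw [Real.norm_eq_abs, abs_le]
    constructor <;> linarith
  have hbi := LI.cube hb c hd
  have hκi : IntegrableOn κ (cube n c d) volume :=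
    Measure.integrableOn_of_bounded (volume_cube_ne_top c hd) hκm.aestronglyMeasurable hκbd
  have hκbi : IntegrableOn (fun y => κ y * b y) (cube n c d) volume :=
    Integrable.bdd_mul hbi hκm.aestronglyMeasurable hκbd
  -- formula
  have hI1 : ∀ u : Rn n → ℝ, Iop n α (fun y => u y * testG n p₁ c d y) (testG n p₂ c' d) x =
      A * B * ∫ y in cube n c d, κ y * u y := by
    intro u
    rw [Iop_testG, ← integral_indicator (measurableSet_cube _ _ _), ← integral_const_mul]
    congr 1; ext y
    unfold testG
    by_cases hy : y ∈ cube n c d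
    · rw [indicator_of_mem hy, indicator_of_mem hy]
      change u y * A * (B * κ y) = A * B * (κ y * u y)
      ring
    · rw [indicator_of_notMem hy, indicator_of_notMem hy]; ring
  have hT : commI n α b (testG n p₁ c d) (testG n p₂ c' d) x =
      A * B * ∫ y in cube n c d, κ y * (b y - b x) := by
    unfold commI
    have h1 := hI1 b
    have h2 := hI1 (fun _ => 1)
    simp only [one_mul, mul_one] at h2
    have h3 : (fun y => testG n p₁ c d y) = testG n p₁ c d := rfl
    rw [h3] at h2
    rw [h1, h2]
    simp_rw [mul_sub]
    rw [integral_sub hκbi (hκi.mul_const _), integral_mul_const]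
    ring
  set m := cubeAvg n b c d with hm
  have hbxi : IntegrableOn (fun y => b y - b x) (cube n c d) volume :=
    hbi.sub (integrableOn_const_cube c hd _)
  have hκbxi : IntegrableOn (fun y => κ y * (b y - b x)) (cube n c d) volume :=
    Integrable.bdd_mul hbxi hκm.aestronglyMeasurable hκbd
  have hdiff : |(∫ y in cube n c d, κ y * (b y - b x)) - K0 * V * (V * (m - b x))| ≤
      K0 * V / 4 * (V * (osc n b c d + |b x - m|)) := by
    have h1 : V * (m - b x) = ∫ y in cube n c d, (b y - b x) := by
      rw [integral_sub hbi (integrableOn_const_cube c hd _), setIntegral_const_cube c hd,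
        ← cubeAvg_mul b c hd]
      ring
    rw [h1, ← integral_const_mul, ← integral_sub hκbxi (hbxi.const_mul _)]
    calc |∫ y in cube n c d, (κ y * (b y - b x) - K0 * V * (b y - b x))|
        ≤ ∫ y in cube n c d, |κ y * (b y - b x) - K0 * V * (b y - b x)| :=
          abs_integral_le_integral_abs
      _ ≤ ∫ y in cube n c d, K0 * V / 4 * (|b y - m| + |b x - m|) := by
          apply setIntegral_mono_on (hκbxi.sub (hbxi.const_mul _)).abs
            (((IOn.abs_sub hd hbi m).add (integrableOn_const_cube c hd _)).const_mul _)
            (measurableSet_cube _ _ _)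
          intro y hy
          have h2 : κ y * (b y - b x) - K0 * V * (b y - b x) = (κ y - K0 * V) * (b y - b x) := by
            ring
          have h3 : |b y - b x| ≤ |b y - m| + |b x - m| := by
            have := abs_sub_le (b y) m (b x)
            rwa [abs_sub_comm m] at this
          change |κ y * (b y - b x) - K0 * V * (b y - b x)| ≤
            K0 * V / 4 * (|b y - m| + |b x - m|)
          rw [h2, abs_mul]
          have := hκb y hy
          gcongr
      _ = K0 * V / 4 * (V * (osc n b c d + |b x - m|)) := by
          rw [integral_const_mul, integral_add (IOn.abs_sub hd hbi m)
            (integrableOn_const_cube c hd _), setIntegral_const_cube c hd, ← osc_mul b c hd]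
          ring
  rw [hT, abs_mul, abs_of_pos (show 0 < A * B by positivity)]
  have h5 : K0 * V ^ 2 * (3 / 4 * |b x - m| - 1 / 4 * osc n b c d) ≤
      |∫ y in cube n c d, κ y * (b y - b x)| := by
    set J := ∫ y in cube n c d, κ y * (b y - b x) with hJ
    have h6 : |K0 * V * (V * (m - b x))| = K0 * V ^ 2 * |b x - m| := by
      rw [abs_mul, abs_mul, abs_mul, abs_of_pos hV0, abs_of_pos hK0, abs_sub_comm m]
      ring
    have h7 := abs_sub_abs_le_abs_sub (K0 * V * (V * (m - b x))) J
    rw [h6, abs_sub_comm _ J] at h7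
    nlinarith
  calc _ = A * B * (K0 * V ^ 2 * (3 / 4 * |b x - m| - 1 / 4 * osc n b c d)) := by ring
    _ ≤ _ := by gcongr

lemma lower_bound {n : ℕ} (hn : 0 < n) {α p₁ p₂ q : ℝ}
    (hq : 1 / q = 1 / p₁ + 1 / p₂ - α / n)
    {b : Rn n → ℝ} (hb : LocallyIntegrable b volume) :
    ∃ L : ℝ, 0 < L ∧ ∃ sh : Rn n → ℝ → Rn n, ∀ (c : Rn n) (d : ℝ), 0 < d →
      IntegrableOn (commI n α b (testG n p₁ c d) (testG n p₂ (sh c d) d)) (cube n c d) volume →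
      L * (d ^ n) ^ (1 - 1 / q) * osc n b c d ≤
        ∫ x in cube n c d, |commI n α b (testG n p₁ c d) (testG n p₂ (sh c d) d) x| := by
  obtain ⟨N, hN0, e, hN⟩ := kernel_close hn (β := (n : ℝ) - α / 2)
  set β := (n : ℝ) - α / 2 with hβ
  refine ⟨(N ^ 2) ^ (-β) / 2, by positivity, fun c d => c + (N * d) • e, ?_⟩
  intro c d hd hI
  set T := commI n α b (testG n p₁ c d) (testG n p₂ (c + (N * d) • e) d) with hT
  have hV0 : 0 < d ^ n := by positivity
  have hn0 : (n : ℝ) ≠ 0 := by positivity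
  have hK0 : 0 < ((N * d) ^ 2) ^ (-β) := by positivity
  have hpt : ∀ x ∈ cube n c d, (d ^ n) ^ (-(1 / p₁)) * (d ^ n) ^ (-(1 / p₂)) *
      ((N * d) ^ 2) ^ (-β) * (d ^ n) ^ 2 *
      (3 / 4 * |b x - cubeAvg n b c d| - 1 / 4 * osc n b c d) ≤ |T x| := by
    intro x hx
    exact comm_pointwise hK0 hb c _ hd (fun y hy z hz => hN c d hd x hx y hy z hz)
  set P := (d ^ n) ^ (-(1 / p₁)) * (d ^ n) ^ (-(1 / p₂)) *
      ((N * d) ^ 2) ^ (-β) * (d ^ n) ^ 2 with hP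
  have hPe : P * d ^ n = (N ^ 2) ^ (-β) * (d ^ n) ^ (1 - 1 / q) := by
    have h1 : ((N * d) ^ 2) ^ (-β) = (N ^ 2) ^ (-β) * (d ^ n) ^ (-2 + α / n) := by
      rw [mul_pow, Real.mul_rpow (by positivity) (by positivity)]
      congr 1
      rw [← Real.rpow_natCast d 2, ← Real.rpow_natCast d n, ← Real.rpow_mul hd.le,
        ← Real.rpow_mul hd.le]
      congr 1
      rw [hβ]; push_cast; field_simp; ring
    have h2 : (d ^ n) ^ 2 = (d ^ n : ℝ) ^ (2 : ℝ) := by norm_cast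
    calc P * d ^ n = (N ^ 2) ^ (-β) * ((d ^ n) ^ (-(1 / p₁)) * (d ^ n) ^ (-(1 / p₂)) *
          (d ^ n) ^ (-2 + α / n) * (d ^ n : ℝ) ^ (2 : ℝ) * (d ^ n) ^ (1 : ℝ)) := by
          rw [hP, h1, ← h2, Real.rpow_one]; ring
      _ = _ := by
          rw [← Real.rpow_add hV0, ← Real.rpow_add hV0, ← Real.rpow_add hV0, ← Real.rpow_add hV0]
          congr 2
          rw [hq]; ring
  have ho := osc_mul b c hd
  have hbi := IOn.abs_sub hd (LI.cube hb c hd) (cubeAvg n b c d)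
  calc (N ^ 2) ^ (-β) / 2 * (d ^ n) ^ (1 - 1 / q) * osc n b c d
      = P * d ^ n * osc n b c d / 2 := by rw [hPe]; ring
    _ = ∫ x in cube n c d, P * (3 / 4 * |b x - cubeAvg n b c d| - 1 / 4 * osc n b c d) := by
        rw [integral_const_mul, integral_sub (hbi.const_mul _) (integrableOn_const_cube c hd _),
          setIntegral_const_cube c hd, integral_const_mul, ← ho]
        ring
    _ ≤ ∫ x in cube n c d, |T x| := by
        apply setIntegral_mono_on
          (((hbi.const_mul _).sub (integrableOn_const_cube c hd _)).const_mul _) hI.abs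
          (measurableSet_cube _ _ _)
        intro x hx
        exact hpt x hx

end lower

section final

lemma far_small {n : ℕ} (hn : 0 < n) {q a M R : ℝ} (hq : 1 < q) (ha : 0 < a) (hM : 0 ≤ M)
    (hR : 0 ≤ R) :
    ∃ J0 : ℕ, ∀ J : ℕ, J0 ≤ J → ∀ (c : Rn n) (d : ℝ), 0 < d →
      (d ≤ 1 / ((J : ℝ) + 1) ∨ (J : ℝ) + 1 ≤ ‖c‖ ∨ (J : ℝ) + 1 ≤ d) →
      M * volume.real (cube n c d ∩ Metric.closedBall 0 R) < a * (d ^ n) ^ (1 - 1 / q) := by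
  have hs : 1 ≤ √(n : ℝ) := by
    rw [Real.one_le_sqrt]; exact_mod_cast hn
  set s := √(n : ℝ) with hsdef
  have hq0 : 0 < 1 / q := by positivity
  have hq1 : 0 < 1 - 1 / q := by
    have : 1 / q < 1 := by rw [div_lt_one (by linarith)]; exact hq
    linarith
  set W := volume.real (Metric.closedBall (0 : Rn n) R) with hW
  have t1 : Tendsto (fun J : ℕ => M * (1 / ((J : ℝ) + 1)) ^ (1 / q)) atTop (𝓝 0) := by
    have h := (tendsto_one_div_add_atTop_nhds_zero_nat (𝕜 := ℝ)).rpow_const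
      (p := 1 / q) (Or.inr hq0.le)
    rw [Real.zero_rpow hq0.ne'] at h
    simpa using h.const_mul M
  have t0 : Tendsto (fun J : ℕ => ((J : ℝ) + 1 - R) / s) atTop atTop := by
    apply Tendsto.atTop_div_const (by linarith)
    have : Tendsto (fun J : ℕ => (J : ℝ) + (1 - R)) atTop atTop :=
      tendsto_atTop_add_const_right _ _ tendsto_natCast_atTop_atTop
    refine this.congr fun J => by ring
  have t2 : Tendsto (fun J : ℕ => a * (((J : ℝ) + 1 - R) / s) ^ (1 - 1 / q)) atTop atTop :=
    ((tendsto_rpow_atTop hq1).comp t0).const_mul_atTop ha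
  have e1 := t1.eventually (gt_mem_nhds ha)
  have e2 := t0.eventually_ge_atTop 1
  have e3 := t2.eventually_gt_atTop (M * W)
  obtain ⟨J0, hJ0⟩ := eventually_atTop.1 ((e1.and e2).and e3)
  refine ⟨J0, fun J hJ c d hd hcase => ?_⟩
  obtain ⟨⟨h1, h2⟩, h3⟩ := hJ0 J hJ
  have hV0 : 0 < d ^ n := by positivity
  have hVp : 0 < (d ^ n) ^ (1 - 1 / q) := by positivity
  have hJp : (0:ℝ) < (J : ℝ) + 1 := by positivity
  by_cases hsm : d ≤ 1 / ((J : ℝ) + 1)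
  · have hv : volume.real (cube n c d ∩ Metric.closedBall 0 R) ≤ d ^ n := by
      rw [← volume_real_cube n c d hd]
      exact measureReal_mono inter_subset_left (volume_cube_ne_top c hd)
    have hd1 : d ≤ 1 := hsm.trans (by
      rw [div_le_one hJp]; have : (0:ℝ) ≤ J := by positivity
      linarith)
    have hVd : d ^ n ≤ d := by
      simpa using pow_le_pow_of_le_one hd.le hd1 hn
    have hsplit : d ^ n = (d ^ n) ^ (1 / q) * (d ^ n) ^ (1 - 1 / q) := by
      rw [← Real.rpow_add hV0]; simp
    have hle : (d ^ n) ^ (1 / q) ≤ (1 / ((J : ℝ) + 1)) ^ (1 / q) :=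
      Real.rpow_le_rpow hV0.le (hVd.trans hsm) hq0.le
    calc M * volume.real (cube n c d ∩ Metric.closedBall 0 R) ≤ M * d ^ n := by gcongr
      _ = (M * (d ^ n) ^ (1 / q)) * (d ^ n) ^ (1 - 1 / q) := by
        rw [mul_assoc, ← hsplit]
      _ ≤ (M * (1 / ((J : ℝ) + 1)) ^ (1 / q)) * (d ^ n) ^ (1 - 1 / q) := by gcongr
      _ < a * (d ^ n) ^ (1 - 1 / q) := by gcongr
  · rcases (cube n c d ∩ Metric.closedBall 0 R).eq_empty_or_nonempty with he | ⟨x, hx, hxR⟩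
    · rw [he]; simp only [measureReal_empty, mul_zero]; positivity
    · have hxc := norm_sub_le_of_mem_cube hd hx
      have hxR' : ‖x‖ ≤ R := by simpa using hxR
      have hcn : ‖c‖ ≤ R + s * d / 2 := by
        have := norm_sub_norm_le c x
        rw [norm_sub_rev] at this
        linarith
      have hsd : d ≤ s * d := by nlinarith
      have hdl : ((J : ℝ) + 1 - R) / s ≤ d := by
        rw [div_le_iff₀ (by linarith)]
        rcases hcase with h | h | h
        · exact absurd h hsm
        · nlinarith
        · nlinarith
      have hd1 : 1 ≤ d := h2.trans hdl
      have hVd : d ≤ d ^ n := by simpa using pow_le_pow_right₀ hd1 hn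
      have hv : volume.real (cube n c d ∩ Metric.closedBall 0 R) ≤ W :=
        measureReal_mono inter_subset_right measure_closedBall_lt_top.ne
      calc M * volume.real (cube n c d ∩ Metric.closedBall 0 R) ≤ M * W := by gcongr
        _ < a * (((J : ℝ) + 1 - R) / s) ^ (1 - 1 / q) := h3
        _ ≤ a * (d ^ n) ^ (1 - 1 / q) := by
          gcongr
          exact hdl.trans hVd

end final

/-- If the commutator `[b,I_α]₁` is compact from
`L^{p₁} × L^{p₂}` to `L^q`, then `b ∈ CMO`. -/
theorem statement2 (n : ℕ) (hn : 0 < n) (p₁ p₂ p q α : ℝ)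
    (hp₁ : 1 < p₁) (hp₂ : 1 < p₂)
    (hp : 1 / p = 1 / p₁ + 1 / p₂)
    (hα₀ : 0 < α) (hα₂ : α < 2 * n)
    (hαp : α / n < 1 / p₁ + 1 / p₂)
    (hq : 1 / q = 1 / p₁ + 1 / p₂ - α / n)
    (hp' : 1 < p) (hq' : 1 < q)
    (b : Rn n → ℝ) (hb : LocallyIntegrable b volume)
    (hcpt : BilinCompact n p₁ p₂ q (fun _ => 1) (fun _ => 1) (fun _ => 1) (commI n α b)) :
    MemCMO n b := by

  apply memCMO_of hn hb
  by_contra! hcon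
  obtain ⟨ε, hε, hcon⟩ := hcon
  have hcon' := fun j : ℕ => hcon ((j : ℝ) + 1) (by positivity)
  choose c d hd hcase hosc using hcon'
  obtain ⟨L, hL, sh, hlow⟩ := lower_bound (p₁ := p₁) (p₂ := p₂) hn hq hb
  obtain ⟨φ, hφ, hC⟩ := hcpt (fun j => testG n p₁ (c j) (d j))
    (fun j => testG n p₂ (sh (c j) (d j)) (d j))
    (fun j => wNorm_testG (by linarith) _ (hd j)) (fun j => wNorm_testG (by linarith) _ (hd j))
  set T : ℕ → Rn n → ℝ := fun j =>
    commI n α b (testG n p₁ (c j) (d j)) (testG n p₂ (sh (c j) (d j)) (d j)) with hT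
  have hTm : ∀ j, MemLp (T j) (ENNReal.ofReal q) volume := fun j =>
    commI_memLp hp₁ hp₂ hq' hb hcpt _ _ (hd j) (hd j)
  have hη : 0 < L * ε / 4 := by positivity
  obtain ⟨N0, hN0⟩ := hC (L * ε / 4) hη
  obtain ⟨M, R, hM, hR, hpair⟩ := small_pairing hq' (hTm (φ N0)) hη
  obtain ⟨J0, hJ0⟩ := far_small hn (a := L * ε / 2) hq' (by positivity) hM hR
  set j := max N0 J0 with hj
  have hjJ : J0 ≤ φ j := (le_max_right _ _).trans (hφ.id_le j)
  set J := φ j with hJ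
  have hfar := hJ0 J hjJ (c J) (d J) (hd J) (hcase J)
  have hcl := hN0 j (le_max_left _ _) N0 le_rfl
  rw [wNorm_eq (by linarith)] at hcl
  have hsub : MemLp (fun x => T J x - T (φ N0) x) (ENNReal.ofReal q) volume :=
    (hTm J).sub (hTm (φ N0))
  obtain ⟨hi, hle⟩ := holder_cube hq' hsub (c J) (hd J) hη.le hcl.le
  have hone : (1 : ℝ≥0∞) ≤ ENNReal.ofReal q := by
    rw [← ENNReal.ofReal_one]; exact ENNReal.ofReal_le_ofReal hq'.le
  have hTi : ∀ k, IntegrableOn (T k) (cube n (c J) (d J)) volume := fun k =>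
    LI.cube ((hTm k).locallyIntegrable hone) (c J) (hd J)
  have hl := hlow (c J) (d J) (hd J) (hTi J)
  have hp0 := hpair (c J) (d J) (hd J)
  have htri : ∫ x in cube n (c J) (d J), |T J x| ≤
      (∫ x in cube n (c J) (d J), |T J x - T (φ N0) x|) +
        ∫ x in cube n (c J) (d J), |T (φ N0) x| := by
    rw [← integral_add hi.abs (hTi (φ N0)).abs]
    refine integral_mono (hTi J).abs (hi.abs.add (hTi (φ N0)).abs) fun x => ?_
    have := abs_add_le (T J x - T (φ N0) x) (T (φ N0) x)
    simpa using this
  have hV : 0 < (d J ^ n) ^ (1 - 1 / q) := by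
    have := hd J
    positivity
  have hlo : L * (d J ^ n) ^ (1 - 1 / q) * ε ≤ L * (d J ^ n) ^ (1 - 1 / q) * osc n b (c J) (d J) :=
    mul_le_mul_of_nonneg_left (hosc J).le (by positivity)
  have hl' : L * (d J ^ n) ^ (1 - 1 / q) * osc n b (c J) (d J) ≤
      ∫ x in cube n (c J) (d J), |T J x| := hl
  nlinarith
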